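/- arXiv:math/9201204 — 4 statements merged into one kernel-verified Lean document; each statement's English description precedes it below -/
import Mathlib

section
/- If C and D are convex bodies in R^n with |P_θ D| ≤ |P_θ C| for all unit vectors θ, and Z = Σ_{i=1}^m α_i[−u_i,u_i] is a zonotope contained in C (u_i unit vectors, α_i > 0), then |D| ≤ (|C| / |Z|)^{1/(n−1)} |C|. -/
open MeasureTheory
open scoped RealInnerProductSpace BigOperators ENNReal
open scoped Pointwise

/-- The Prékopa–Leindler inequality as a property of a measure on a real vector space. -/
def PrekopaLeindler {E : Type*} [AddCommGroup E] [Module ℝ E] [MeasurableSpace E]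
    (μ : Measure E) : Prop :=
  ∀ ⦃a b : ℝ⦄, 0 < a → 0 < b → a + b = 1 → ∀ ⦃f g h : E → ℝ≥0∞⦄,
    Measurable f → Measurable g → Measurable h →
    (∀ x y, f x ^ a * g y ^ b ≤ h (a • x + b • y)) →
    (∫⁻ x, f x ∂μ) ^ a * (∫⁻ x, g x ∂μ) ^ b ≤ ∫⁻ x, h x ∂μ

lemma Real.volume_add_le_of_isCompact {A B C : Set ℝ} (hA : IsCompact A) (hB : IsCompact B)
    (hAn : A.Nonempty) (hBn : B.Nonempty) (hC : ∀ x ∈ A, ∀ y ∈ B, x + y ∈ C) :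
    volume A + volume B ≤ volume C := by
  obtain ⟨a, ha, hamax⟩ := hA.exists_isGreatest hAn
  obtain ⟨b, hb, hbmin⟩ := hB.exists_isLeast hBn
  have hsub : (fun x => x + b) '' A ∪ (fun y => a + y) '' B ⊆ C := by
    rintro _ (⟨x, hx, rfl⟩ | ⟨y, hy, rfl⟩)
    exacts [hC x hx b hb, hC a ha y hy]
  have hinter : (fun x => x + b) '' A ∩ (fun y => a + y) '' B ⊆ {a + b} := by
    rintro _ ⟨⟨x, hx, rfl⟩, ⟨y, hy, hxy⟩⟩
    have h1 := hamax hx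
    have h2 := hbmin hy
    simp only [Set.mem_singleton_iff] at hxy ⊢
    linarith
  have hd : AEDisjoint volume ((fun x => x + b) '' A) ((fun y => a + y) '' B) :=
    measure_mono_null hinter (by simp)
  have hBm : NullMeasurableSet ((fun y => a + y) '' B) volume :=
    (hB.image (by fun_prop)).measurableSet.nullMeasurableSet
  calc volume A + volume B
      = volume ((fun x => x + b) '' A) + volume ((fun y => a + y) '' B) := by simp
    _ = volume ((fun x => x + b) '' A ∪ (fun y => a + y) '' B) := (measure_union₀ hBm hd).symm
    _ ≤ volume C := measure_mono hsub

/-- The one-dimensional Brunn–Minkowski inequality. -/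
lemma Real.volume_add_le {A B C : Set ℝ} (hA : MeasurableSet A) (hB : MeasurableSet B)
    (hAn : A.Nonempty) (hBn : B.Nonempty) (hC : ∀ x ∈ A, ∀ y ∈ B, x + y ∈ C) :
    volume A + volume B ≤ volume C := by
  obtain ⟨a, ha⟩ := hAn
  obtain ⟨b, hb⟩ := hBn
  rw [hA.measure_eq_iSup_isCompact, hB.measure_eq_iSup_isCompact]
  simp only [iSup_and']
  refine ENNReal.biSup_add_biSup_le' (p := fun K => K ⊆ A ∧ IsCompact K)
    (q := fun K => K ⊆ B ∧ IsCompact K) ⟨∅, by simp⟩ ⟨∅, by simp⟩ fun K hK K' hK' => ?_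
  refine (add_le_add (measure_mono (Set.subset_insert a K))
    (measure_mono (Set.subset_insert b K'))).trans ?_
  refine Real.volume_add_le_of_isCompact (hK.2.insert a) (hK'.2.insert b)
    (Set.insert_nonempty _ _) (Set.insert_nonempty _ _) fun x hx y hy => hC x ?_ y ?_
  · exact Set.insert_subset ha hK.1 hx
  · exact Set.insert_subset hb hK'.1 hy

lemma lintegral_min_one_eq_lintegral_meas_lt {E : Type*} [MeasurableSpace E] (μ : Measure E)
    {f : E → ℝ≥0∞} (hf : Measurable f) :
    ∫⁻ x, min (f x) 1 ∂μ = ∫⁻ s in Set.Ioo (0 : ℝ) 1, μ {x | ENNReal.ofReal s < f x} := by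
  have h1 : ∀ x, min (f x) 1 ≠ ∞ := fun x => ((min_le_right _ _).trans_lt ENNReal.one_lt_top).ne
  have h2 := lintegral_eq_lintegral_meas_lt μ (f := fun x => (min (f x) 1).toReal)
    (Filter.Eventually.of_forall fun _ => ENNReal.toReal_nonneg)
    (hf.min measurable_const).ennreal_toReal.aemeasurable
  simp only [ENNReal.ofReal_toReal (h1 _)] at h2
  have h3 : ∀ s : ℝ, 0 < s → {x | s < (min (f x) 1).toReal}
      = {x | ENNReal.ofReal s < f x ∧ s < 1} := by
    intro s hs
    ext x
    simp only [Set.mem_ofPred_eq]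
    rw [← ENNReal.ofReal_lt_iff_lt_toReal hs.le (h1 x), lt_min_iff]
    simp
  rw [h2, ← Set.Ioo_union_Ici_eq_Ioi (zero_lt_one (α := ℝ)),
    lintegral_union measurableSet_Ici (Set.disjoint_left.2 fun x hx hx' => hx.2.not_ge hx')]
  rw [setLIntegral_congr_fun (g := fun s => μ {x | ENNReal.ofReal s < f x}) measurableSet_Ioo,
    setLIntegral_congr_fun (g := fun s => 0) measurableSet_Ici]
  · simp
  · intro s hs
    have hs : 1 ≤ s := hs
    simp only [h3 s (by linarith), hs.not_gt, and_false, Set.ofPred_false, measure_empty]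
  · intro s hs
    simp only [h3 s hs.1, hs.2, and_true]

lemma ENNReal.rpow_mul_rpow_le_add {a b : ℝ} (ha : 0 < a) (hb : 0 < b) (hab : a + b = 1)
    (x y : ℝ≥0∞) : x ^ a * y ^ b ≤ ENNReal.ofReal a * x + ENNReal.ofReal b * y := by
  have hpq : (a⁻¹).HolderConjugate b⁻¹ := by
    rw [Real.holderConjugate_iff]
    refine ⟨(one_lt_inv₀ ha).2 (by linarith), by simpa using hab⟩
  have := ENNReal.young_inequality (x ^ a) (y ^ b) hpq
  rw [← ENNReal.rpow_mul, ← ENNReal.rpow_mul, mul_inv_cancel₀ ha.ne', mul_inv_cancel₀ hb.ne',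
    ENNReal.rpow_one, ENNReal.rpow_one, ENNReal.ofReal_inv_of_pos ha, ENNReal.ofReal_inv_of_pos hb,
    div_eq_mul_inv, div_eq_mul_inv, inv_inv, inv_inv] at this
  rwa [mul_comm _ x, mul_comm _ y]

lemma Real.prekopaLeindler_of_iSup_eq_one {a b : ℝ} (ha : 0 < a) (hb : 0 < b) (hab : a + b = 1)
    {f g h : ℝ → ℝ≥0∞} (hf : Measurable f) (hg : Measurable g) (hh : Measurable h)
    (H : ∀ x y, f x ^ a * g y ^ b ≤ h (a • x + b • y)) (hf1 : ⨆ x, f x = 1) (hg1 : ⨆ x, g x = 1) :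
    (∫⁻ x, f x) ^ a * (∫⁻ x, g x) ^ b ≤ ∫⁻ x, h x := by
  have hf' : ∀ x, min (f x) 1 = f x := fun x => min_eq_left (hf1 ▸ le_iSup f x)
  have hg' : ∀ x, min (g x) 1 = g x := fun x => min_eq_left (hg1 ▸ le_iSup g x)
  refine (ENNReal.rpow_mul_rpow_le_add ha hb hab _ _).trans ?_
  have key : ∀ s ∈ Set.Ioo (0 : ℝ) 1,
      ENNReal.ofReal a * volume {x | ENNReal.ofReal s < f x}
        + ENNReal.ofReal b * volume {x | ENNReal.ofReal s < g x}
      ≤ volume {x | ENNReal.ofReal s < h x} := by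
    intro s hs
    have hs1 : ENNReal.ofReal s < 1 := by simpa using hs.2
    obtain ⟨x₀, hx₀⟩ := lt_iSup_iff.1 (hf1 ▸ hs1)
    obtain ⟨y₀, hy₀⟩ := lt_iSup_iff.1 (hg1 ▸ hs1)
    have e1 : ENNReal.ofReal a * volume {x | ENNReal.ofReal s < f x}
        = volume (a • {x | ENNReal.ofReal s < f x}) := by
      rw [Measure.addHaar_smul_of_nonneg _ ha.le]; simp
    have e2 : ENNReal.ofReal b * volume {x | ENNReal.ofReal s < g x}
        = volume (b • {x | ENNReal.ofReal s < g x}) := by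
      rw [Measure.addHaar_smul_of_nonneg _ hb.le]; simp
    rw [e1, e2]
    refine Real.volume_add_le ((measurableSet_lt measurable_const hf).const_smul₀ a)
      ((measurableSet_lt measurable_const hg).const_smul₀ b)
      ⟨_, Set.smul_mem_smul_set hx₀⟩ ⟨_, Set.smul_mem_smul_set hy₀⟩ ?_
    rintro _ ⟨x, hx, rfl⟩ _ ⟨y, hy, rfl⟩
    refine lt_of_lt_of_le ?_ (H x y)
    have hs0 : ENNReal.ofReal s ≠ 0 := by simpa using hs.1
    calc ENNReal.ofReal s = ENNReal.ofReal s ^ a * ENNReal.ofReal s ^ b := by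
          rw [← ENNReal.rpow_add _ _ hs0 ENNReal.ofReal_ne_top, hab, ENNReal.rpow_one]
      _ < f x ^ a * g y ^ b :=
          ENNReal.mul_lt_mul (ENNReal.rpow_lt_rpow hx ha) (ENNReal.rpow_lt_rpow hy hb)
  calc ENNReal.ofReal a * (∫⁻ x, f x) + ENNReal.ofReal b * ∫⁻ x, g x
      = ENNReal.ofReal a * (∫⁻ x, min (f x) 1) + ENNReal.ofReal b * ∫⁻ x, min (g x) 1 := by
        simp only [hf', hg']
    _ ≤ ∫⁻ s in Set.Ioo (0 : ℝ) 1, volume {x | ENNReal.ofReal s < h x} := by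
        rw [lintegral_min_one_eq_lintegral_meas_lt _ hf, lintegral_min_one_eq_lintegral_meas_lt _ hg,
          ← lintegral_const_mul' _ _ ENNReal.ofReal_ne_top,
          ← lintegral_const_mul' _ _ ENNReal.ofReal_ne_top]
        refine (le_lintegral_add _ _).trans ?_
        exact setLIntegral_mono' measurableSet_Ioo key
    _ = ∫⁻ x, min (h x) 1 := (lintegral_min_one_eq_lintegral_meas_lt _ hh).symm
    _ ≤ ∫⁻ x, h x := lintegral_mono fun x => min_le_left _ _

lemma Real.prekopaLeindler_of_iSup_ne_top {a b : ℝ} (ha : 0 < a) (hb : 0 < b) (hab : a + b = 1)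
    {f g h : ℝ → ℝ≥0∞} (hf : Measurable f) (hg : Measurable g) (hh : Measurable h)
    (H : ∀ x y, f x ^ a * g y ^ b ≤ h (a • x + b • y)) (hft : ⨆ x, f x ≠ ∞) (hgt : ⨆ x, g x ≠ ∞) :
    (∫⁻ x, f x) ^ a * (∫⁻ x, g x) ^ b ≤ ∫⁻ x, h x := by
  set F := ⨆ x, f x with hF
  set G := ⨆ x, g x with hG
  rcases eq_or_ne F 0 with hF0 | hF0
  · have : ∀ x, f x = 0 := fun x => le_antisymm (hF0 ▸ le_iSup f x) zero_le
    simp [this, ha]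
  rcases eq_or_ne G 0 with hG0 | hG0
  · have : ∀ x, g x = 0 := fun x => le_antisymm (hG0 ▸ le_iSup g x) zero_le
    simp [this, hb]
  have e : ∀ u v : ℝ≥0∞, (F⁻¹ * u) ^ a * (G⁻¹ * v) ^ b = (F ^ a * G ^ b)⁻¹ * (u ^ a * v ^ b) := by
    intro u v
    rw [ENNReal.mul_rpow_of_nonneg _ _ ha.le, ENNReal.mul_rpow_of_nonneg _ _ hb.le,
      ENNReal.inv_rpow, ENNReal.inv_rpow, ENNReal.mul_inv (by simp [ha, hF0, ha.le]) (by simp [hft, ha, hF0])]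
    ring
  have hc0 : F ^ a * G ^ b ≠ 0 := by simp [ha, hb, hF0, hG0, hft, hgt]
  have hct : F ^ a * G ^ b ≠ ∞ :=
    ENNReal.mul_ne_top (ENNReal.rpow_ne_top_of_nonneg ha.le hft)
      (ENNReal.rpow_ne_top_of_nonneg hb.le hgt)
  have := Real.prekopaLeindler_of_iSup_eq_one ha hb hab (f := fun x => F⁻¹ * f x)
    (g := fun x => G⁻¹ * g x) (h := fun x => (F ^ a * G ^ b)⁻¹ * h x)
    (hf.const_mul _) (hg.const_mul _) (hh.const_mul _)
    (fun x y => by rw [e]; gcongr; exact H x y)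
    (by rw [← ENNReal.mul_iSup, ENNReal.inv_mul_cancel hF0 hft])
    (by rw [← ENNReal.mul_iSup, ENNReal.inv_mul_cancel hG0 hgt])
  rw [lintegral_const_mul _ hf, lintegral_const_mul _ hg, lintegral_const_mul _ hh, e] at this
  exact (ENNReal.mul_le_mul_iff_right (ENNReal.inv_ne_zero.2 hct) (ENNReal.inv_ne_top.2 hc0)).1 this

lemma lintegral_min_natCast_tendsto {E : Type*} [MeasurableSpace E] (μ : Measure E)
    {f : E → ℝ≥0∞} (hf : Measurable f) :
    Filter.Tendsto (fun N : ℕ => ∫⁻ x, min (f x) N ∂μ) Filter.atTop (nhds (∫⁻ x, f x ∂μ)) := by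
  refine lintegral_tendsto_of_tendsto_of_monotone (fun N => (hf.min measurable_const).aemeasurable)
    (Filter.Eventually.of_forall fun x N M hNM => min_le_min_left _ (by exact_mod_cast hNM))
    (Filter.Eventually.of_forall fun x => ?_)
  have : Filter.Tendsto (fun N : ℕ => min (f x) (N : ℝ≥0∞)) Filter.atTop (nhds (min (f x) ∞)) :=
    tendsto_const_nhds.min ENNReal.tendsto_nat_nhds_top
  simpa using this

theorem Real.prekopaLeindler : PrekopaLeindler (volume : Measure ℝ) := by
  intro a b ha hb hab f g h hf hg hh H
  rcases eq_or_ne (∫⁻ x, f x) 0 with hf0 | hf0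
  · simp [hf0, ha]
  rcases eq_or_ne (∫⁻ x, g x) 0 with hg0 | hg0
  · simp [hg0, hb]
  have hb' : ∀ (f : ℝ → ℝ≥0∞) (N : ℕ), ⨆ x, min (f x) (N : ℝ≥0∞) ≠ ∞ := fun f N =>
    ((iSup_le fun x => min_le_right _ _).trans_lt (ENNReal.natCast_lt_top N)).ne
  have ht := ENNReal.Tendsto.mul
    (((ENNReal.continuous_rpow_const (y := a)).tendsto _).comp (lintegral_min_natCast_tendsto volume hf))
    (Or.inl (by simp [hf0, ha, ha.le]))
    (((ENNReal.continuous_rpow_const (y := b)).tendsto _).comp (lintegral_min_natCast_tendsto volume hg))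
    (Or.inl (by simp [hg0, hb, hb.le]))
  refine le_of_tendsto' ht fun N => ?_
  refine Real.prekopaLeindler_of_iSup_ne_top ha hb hab (hf.min measurable_const)
    (hg.min measurable_const) hh (fun x y => le_trans ?_ (H x y)) (hb' f N) (hb' g N)
  gcongr <;> exact min_le_left _ _

lemma PrekopaLeindler.prod {E F : Type*} [AddCommGroup E] [Module ℝ E] [MeasurableSpace E]
    [AddCommGroup F] [Module ℝ F] [MeasurableSpace F] {μ : Measure E} {ν : Measure F} [SFinite ν]
    (hμ : PrekopaLeindler μ) (hν : PrekopaLeindler ν) : PrekopaLeindler (μ.prod ν) := by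
  intro a b ha hb hab f g h hf hg hh H
  rw [lintegral_prod _ hf.aemeasurable, lintegral_prod _ hg.aemeasurable,
    lintegral_prod _ hh.aemeasurable]
  refine hμ ha hb hab hf.lintegral_prod_right' hg.lintegral_prod_right' hh.lintegral_prod_right' ?_
  intro x x'
  exact hν ha hb hab (hf.comp measurable_prodMk_left) (hg.comp measurable_prodMk_left)
    (hh.comp measurable_prodMk_left) fun y y' => H (x, y) (x', y')

lemma PrekopaLeindler.of_measurePreserving {E F : Type*} [AddCommGroup E] [Module ℝ E]
    [MeasurableSpace E] [AddCommGroup F] [Module ℝ F] [MeasurableSpace F] {μ : Measure E}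
    {ν : Measure F} (hμ : PrekopaLeindler μ) (e : E → F) (he : MeasurePreserving e μ ν)
    (hlin : IsLinearMap ℝ e) : PrekopaLeindler ν := by
  intro a b ha hb hab f g h hf hg hh H
  rw [← he.lintegral_comp hf, ← he.lintegral_comp hg, ← he.lintegral_comp hh]
  refine hμ ha hb hab (hf.comp he.measurable) (hg.comp he.measurable) (hh.comp he.measurable) ?_
  intro x y
  rw [hlin.map_add, hlin.map_smul, hlin.map_smul]
  exact H _ _

lemma prekopaLeindler_dirac_zero {E : Type*} [AddCommGroup E] [Module ℝ E] [MeasurableSpace E] :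
    PrekopaLeindler (Measure.dirac (0 : E)) := by
  intro a b ha hb hab f g h hf hg hh H
  rw [lintegral_dirac' _ hf, lintegral_dirac' _ hg, lintegral_dirac' _ hh]
  simpa using H 0 0

theorem prekopaLeindler_pi : ∀ n : ℕ, PrekopaLeindler (volume : Measure (Fin n → ℝ))
  | 0 => by
    rw [volume_pi, Measure.pi_of_empty _ 0]
    exact prekopaLeindler_dirac_zero
  | n + 1 => by
    refine (Real.prekopaLeindler.prod (prekopaLeindler_pi n)).of_measurePreserving _
      (volume_preserving_piFinSuccAbove (fun _ => ℝ) 0).symm ⟨fun x y => ?_, fun c x => ?_⟩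
    all_goals
      ext i
      refine Fin.cases ?_ (fun j => ?_) i <;> simp [MeasurableEquiv.piFinSuccAbove]

theorem EuclideanSpace.prekopaLeindler (n : ℕ) :
    PrekopaLeindler (volume : Measure (EuclideanSpace ℝ (Fin n))) :=
  (prekopaLeindler_pi n).of_measurePreserving _ (PiLp.volume_preserving_toLp (Fin n))
    ⟨fun _ _ => rfl, fun _ _ => rfl⟩

/-- The multiplicative Brunn–Minkowski inequality. -/
theorem EuclideanSpace.volume_rpow_mul_volume_rpow_le {n : ℕ} {a b : ℝ} (ha : 0 < a) (hb : 0 < b)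
    (hab : a + b = 1) {A B : Set (EuclideanSpace ℝ (Fin n))} (hA : IsCompact A)
    (hB : IsCompact B) :
    volume A ^ a * volume B ^ b ≤ volume (a • A + b • B) := by
  have hC : IsCompact (a • A + b • B) := (hA.smul a).add (hB.smul b)
  have := EuclideanSpace.prekopaLeindler n ha hb hab (f := A.indicator 1) (g := B.indicator 1)
    (h := (a • A + b • B).indicator 1) (measurable_one.indicator hA.measurableSet)
    (measurable_one.indicator hB.measurableSet) (measurable_one.indicator hC.measurableSet) ?_
  · rwa [lintegral_indicator_one hA.measurableSet, lintegral_indicator_one hB.measurableSet,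
      lintegral_indicator_one hC.measurableSet] at this
  · intro x y
    by_cases hx : x ∈ A
    · by_cases hy : y ∈ B
      · have : a • x + b • y ∈ a • A + b • B :=
          Set.add_mem_add (Set.smul_mem_smul_set hx) (Set.smul_mem_smul_set hy)
        simp [hx, hy, this]
      · simp [hy, hb]
    · simp [hx, ha]

lemma Convex.volume_add_Icc_of_isCompact {A : Set ℝ} (hA : Convex ℝ A) (hAc : IsCompact A)
    (hAn : A.Nonempty) {r : ℝ} (hr : 0 ≤ r) :
    volume (A + Set.Icc (-r) r) = volume A + ENNReal.ofReal (2 * r) := by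
  have hconn : IsConnected A := ⟨hAn, hA.isPreconnected⟩
  have hle : sInf A ≤ sSup A := csInf_le_csSup hAn hAc.bddBelow hAc.bddAbove
  rw [eq_Icc_of_connected_compact hconn hAc, Set.Icc_add_Icc hle (by linarith), Real.volume_Icc,
    Real.volume_Icc, ← ENNReal.ofReal_add (by linarith) (by linarith)]
  congr 1
  ring

section Shadow

variable {V : Type*} [NormedAddCommGroup V] [InnerProductSpace ℝ V]

/-- The segment `[-r θ, r θ]`. -/
def centeredSegment (θ : V) (r : ℝ) : Set V := (fun t : ℝ => t • θ) '' Set.Icc (-r) r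

lemma isCompact_centeredSegment (θ : V) (r : ℝ) : IsCompact (centeredSegment θ r) :=
  isCompact_Icc.image (by fun_prop)

lemma convex_centeredSegment (θ : V) (r : ℝ) : Convex ℝ (centeredSegment θ r) :=
  (convex_Icc _ _).is_linear_image (f := fun t : ℝ => t • θ)
    ⟨fun _ _ => add_smul _ _ _, fun _ _ => smul_assoc _ _ _⟩

lemma zero_mem_centeredSegment (θ : V) {r : ℝ} (hr : 0 ≤ r) : 0 ∈ centeredSegment θ r :=
  ⟨0, ⟨by linarith, hr⟩, zero_smul _ _⟩

lemma smul_centeredSegment (θ : V) {r t : ℝ} (hr : 0 ≤ r) (ht : 0 ≤ t) :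
    t • centeredSegment θ r = centeredSegment θ (t * r) := by
  have : Set.Icc (-(t * r)) (t * r) = (fun x : ℝ => t * x) '' Set.Icc (-r) r := by
    rw [Set.image_mul_left_Icc ht (by linarith), mul_neg]
  rw [centeredSegment, centeredSegment, this, Set.image_image, ← Set.image_smul, Set.image_image]
  simp [mul_smul]

lemma isCompact_add_sum_centeredSegment {ι : Type*} {K : Set V} (hKc : IsCompact K)
    (θ : ι → V) (r : ι → ℝ) (s : Finset ι) :
    IsCompact (K + ∑ i ∈ s, centeredSegment (θ i) (r i)) := by
  classical
  induction s using Finset.induction_on with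
  | empty => simpa using hKc
  | insert j s hj ih =>
    rw [Finset.sum_insert hj, add_comm (centeredSegment _ _), ← add_assoc]
    exact ih.add (isCompact_centeredSegment _ _)

lemma convex_add_sum_centeredSegment {ι : Type*} {K : Set V} (hK : Convex ℝ K)
    (θ : ι → V) (r : ι → ℝ) (s : Finset ι) :
    Convex ℝ (K + ∑ i ∈ s, centeredSegment (θ i) (r i)) := by
  classical
  induction s using Finset.induction_on with
  | empty => simpa using hK
  | insert j s hj ih =>
    rw [Finset.sum_insert hj, add_comm (centeredSegment _ _), ← add_assoc]
    exact ih.add (convex_centeredSegment _ _)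

lemma subset_add_centeredSegment (K : Set V) (θ : V) {r : ℝ} (hr : 0 ≤ r) :
    K ⊆ K + centeredSegment θ r :=
  Set.subset_add_left _ (zero_mem_centeredSegment θ hr)

lemma subset_add_sum_centeredSegment {ι : Type*} (K : Set V) (θ : ι → V) {r : ι → ℝ}
    (hr : ∀ i, 0 ≤ r i) (s : Finset ι) : K ⊆ K + ∑ i ∈ s, centeredSegment (θ i) (r i) := by
  classical
  induction s using Finset.induction_on with
  | empty => simp
  | insert j s hj ih =>
    rw [Finset.sum_insert hj, add_comm (centeredSegment _ _), ← add_assoc]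
    exact ih.trans (subset_add_centeredSegment _ _ (hr j))

lemma setOf_exists_add_smul_mem {θ : V} (K : Set V) :
    {y : (ℝ ∙ θ)ᗮ | ∃ t : ℝ, (y : V) + t • θ ∈ K} = (ℝ ∙ θ)ᗮ.orthogonalProjectionOnto '' K := by
  ext y
  constructor
  · rintro ⟨t, ht⟩
    refine ⟨_, ht, ?_⟩
    have h2 : (ℝ ∙ θ)ᗮ.orthogonalProjectionOnto (t • θ) = 0 := by
      apply Submodule.orthogonalProjectionOnto_orthogonal_apply_eq_zero
      exact Submodule.smul_mem _ _ (Submodule.mem_span_singleton_self θ)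
    simp [map_add, h2]
  · rintro ⟨x, hx, rfl⟩
    obtain ⟨t, ht⟩ := Submodule.mem_span_singleton.1 ((ℝ ∙ θ).orthogonalProjectionOnto x).2
    refine ⟨t, ?_⟩
    rw [ht]
    convert hx
    rw [add_comm]
    exact ((ℝ ∙ θ).starProjection_add_starProjection_orthogonal x)

variable [MeasurableSpace V] [BorelSpace V]

/-- The volume of the orthogonal projection of `K` onto the hyperplane `θᗮ`. -/
noncomputable def shadowVolume (θ : V) (K : Set V) : ℝ≥0∞ :=
  μHE[Module.finrank ℝ V - 1] ((fun x => x - ⟪θ, x⟫ • θ) '' K)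

lemma shadowVolume_mono (θ : V) {K L : Set V} (h : K ⊆ L) : shadowVolume θ K ≤ shadowVolume θ L :=
  measure_mono (Set.image_mono h)

lemma shadowVolume_homothety_image (θ x : V) {c : ℝ} (hc : 0 < c) (K : Set V) :
    shadowVolume θ (AffineMap.homothety x c '' K)
      = ENNReal.ofReal (c ^ (Module.finrank ℝ V - 1)) * shadowVolume θ K := by
  rw [shadowVolume, shadowVolume, Set.image_image]
  have : (fun y => AffineMap.homothety x c y - ⟪θ, AffineMap.homothety x c y⟫ • θ)
      = fun y => AffineMap.homothety (x - ⟪θ, x⟫ • θ) c (y - ⟪θ, y⟫ • θ) := by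
    ext y
    simp only [AffineMap.homothety_apply, vsub_eq_sub, vadd_eq_add, inner_add_right,
      inner_smul_right, inner_sub_right]
    module
  rw [this, ← Set.image_image (AffineMap.homothety (x - ⟪θ, x⟫ • θ) c),
    euclideanHausdorffMeasure_homothety_image _ _ hc.ne', ENNReal.smul_def, smul_eq_mul,
    ENNReal.ofReal_pow hc.le]
  congr 1
  push_cast
  rw [← Real.enorm_eq_ofReal hc.le]
  rfl

variable [FiniteDimensional ℝ V]

lemma volume_eq_lintegral_line {θ : V} (hθ : ‖θ‖ = 1) {K : Set V} (hK : MeasurableSet K) :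
    volume K = ∫⁻ y : (ℝ ∙ θ)ᗮ, volume {t : ℝ | (y : V) + t • θ ∈ K} := by
  have hmp := (ℝ ∙ θ).measurePreserving_measurableEquivProd (0 : V)
  rw [InnerProductSpace.euclideanHausdorffMeasure_eq_volume] at hmp
  rw [← hmp.symm.measure_preimage_equiv, Measure.volume_eq_prod,
    Measure.prod_apply_symm (hK.preimage (MeasurableEquiv.measurable _))]
  congr with y
  have hL := (LinearIsometryEquiv.toSpanUnitSingleton (𝕜 := ℝ) θ hθ).measurePreserving
  rw [← hL.measure_preimage_emb (LinearIsometryEquiv.toSpanUnitSingleton (𝕜 := ℝ) θ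
    hθ).toHomeomorph.measurableEmbedding]
  congr 1
  ext t
  simp [add_comm]

lemma shadowVolume_eq {θ : V} (hθ : ‖θ‖ = 1) (K : Set V) :
    shadowVolume θ K = volume {y : (ℝ ∙ θ)ᗮ | ∃ t : ℝ, (y : V) + t • θ ∈ K} := by
  have hr : Module.finrank ℝ V - 1 = Module.finrank ℝ (ℝ ∙ θ)ᗮ := by
    rw [← (ℝ ∙ θ).finrank_add_finrank_orthogonal, finrank_span_singleton
      (by rintro rfl; simp at hθ), Nat.add_sub_cancel_left]
  rw [shadowVolume, hr, ← InnerProductSpace.euclideanHausdorffMeasure_eq_volume,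
    ← (isometry_subtype_coe (s := ((ℝ ∙ θ)ᗮ : Set V))).euclideanHausdorffMeasure_image]
  congr 1
  ext x
  simp only [Set.mem_image]
  constructor
  · rintro ⟨z, hz, rfl⟩
    refine ⟨⟨z - ⟪θ, z⟫ • θ, ?_⟩, ⟨⟪θ, z⟫, by simpa using hz⟩, rfl⟩
    rw [SetLike.mem_coe, Submodule.mem_orthogonal_singleton_iff_inner_right, inner_sub_right, inner_smul_right,
      real_inner_self_eq_norm_sq, hθ]
    simp
  · rintro ⟨y, ⟨t, ht⟩, rfl⟩
    refine ⟨_, ht, ?_⟩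
    have := Submodule.mem_orthogonal_singleton_iff_inner_right.1 y.2
    rw [inner_add_right, inner_smul_right, real_inner_self_eq_norm_sq, hθ, this]
    simp

lemma IsCompact.shadowVolume_ne_top {θ : V} (hθ : ‖θ‖ = 1) {K : Set V} (hK : IsCompact K) :
    shadowVolume θ K ≠ ∞ := by
  rw [shadowVolume_eq hθ, setOf_exists_add_smul_mem]
  exact (hK.image (ContinuousLinearMap.continuous _)).measure_lt_top.ne

lemma Convex.volume_add_centeredSegment {θ : V} (hθ : ‖θ‖ = 1) {K : Set V} (hK : Convex ℝ K)
    (hKc : IsCompact K) {r : ℝ} (hr : 0 ≤ r) :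
    volume (K + centeredSegment θ r) = volume K + ENNReal.ofReal (2 * r) * shadowVolume θ K := by
  have hm : MeasurableSet {y : (ℝ ∙ θ)ᗮ | ∃ t : ℝ, (y : V) + t • θ ∈ K} := by
    rw [setOf_exists_add_smul_mem]
    exact (hKc.image (ContinuousLinearMap.continuous _)).measurableSet
  rw [shadowVolume_eq hθ, volume_eq_lintegral_line hθ
    (hKc.add (isCompact_centeredSegment θ r)).measurableSet,
    volume_eq_lintegral_line hθ hKc.measurableSet, ← lintegral_indicator_const hm,
    ← lintegral_add_right _ (measurable_const.indicator hm)]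
  congr with y
  have hsl : {t : ℝ | (y : V) + t • θ ∈ K + centeredSegment θ r}
      = {t : ℝ | (y : V) + t • θ ∈ K} + Set.Icc (-r) r := by
    ext t
    constructor
    · rintro ⟨x, hx, _, ⟨s, hs, rfl⟩, hxs⟩
      refine ⟨t - s, ?_, s, hs, sub_add_cancel _ _⟩
      have : (y : V) + (t - s) • θ = x := by
        rw [sub_smul, ← add_sub_assoc, ← hxs]
        simp
      simpa [this] using hx
    · rintro ⟨t', ht', s, hs, rfl⟩
      exact ⟨_, ht', _, ⟨s, hs, rfl⟩, by simp [add_smul, add_assoc]⟩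
  rw [hsl]
  by_cases hy : ∃ t : ℝ, (y : V) + t • θ ∈ K
  · rw [Set.indicator_of_mem (by exact hy)]
    have hpre : {t : ℝ | (y : V) + t • θ ∈ K}
        = AffineMap.lineMap (k := ℝ) (y : V) ((y : V) + θ) ⁻¹' K := by
      ext t
      simp [AffineMap.lineMap_apply, add_comm]
    have hiso : Isometry (AffineMap.lineMap (k := ℝ) (y : V) ((y : V) + θ)) :=
      Isometry.of_dist_eq fun s t => by simp [dist_lineMap_lineMap, hθ]
    rw [hpre]
    exact (hK.affine_preimage _).volume_add_Icc_of_isCompact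
      (hiso.isClosedEmbedding.isCompact_preimage hKc) (hpre ▸ hy) hr
  · rw [Set.indicator_of_notMem (by exact hy)]
    have : {t : ℝ | (y : V) + t • θ ∈ K} = ∅ := by
      ext t; simpa using fun h => hy ⟨t, h⟩
    simp [this]

lemma Convex.le_volume_add_sum_centeredSegment {ι : Type*} {K : Set V} (hK : Convex ℝ K)
    (hKc : IsCompact K) {θ : ι → V} (hθ : ∀ i, ‖θ i‖ = 1) {r : ι → ℝ} (hr : ∀ i, 0 ≤ r i)
    (s : Finset ι) :
    volume K + ∑ i ∈ s, ENNReal.ofReal (2 * r i) * shadowVolume (θ i) K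
      ≤ volume (K + ∑ i ∈ s, centeredSegment (θ i) (r i)) := by
  classical
  induction s using Finset.induction_on with
  | empty => simp
  | insert j s hj ih =>
    rw [Finset.sum_insert hj, Finset.sum_insert hj, add_comm (centeredSegment _ _), ← add_assoc K,
      (convex_add_sum_centeredSegment hK θ r s).volume_add_centeredSegment (hθ j)
        (isCompact_add_sum_centeredSegment hKc θ r s) (hr j),
      add_comm (ENNReal.ofReal _ * _), ← add_assoc]
    gcongr
    exact shadowVolume_mono _ (subset_add_sum_centeredSegment K θ hr s)

lemma Convex.volume_add_sum_centeredSegment_le {ι : Type*} {K W : Set V} (hK : Convex ℝ K)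
    (hKc : IsCompact K) {θ : ι → V} (hθ : ∀ i, ‖θ i‖ = 1) {r : ι → ℝ} (hr : ∀ i, 0 ≤ r i)
    (s : Finset ι) (hW : K + ∑ i ∈ s, centeredSegment (θ i) (r i) ⊆ W) :
    volume (K + ∑ i ∈ s, centeredSegment (θ i) (r i))
      ≤ volume K + ∑ i ∈ s, ENNReal.ofReal (2 * r i) * shadowVolume (θ i) W := by
  classical
  induction s using Finset.induction_on with
  | empty => simp
  | insert j s hj ih =>
    rw [Finset.sum_insert hj, add_comm (centeredSegment _ _), ← add_assoc K] at hW ⊢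
    have hW' := (subset_add_centeredSegment _ (θ j) (hr j)).trans hW
    rw [(convex_add_sum_centeredSegment hK θ r s).volume_add_centeredSegment (hθ j)
        (isCompact_add_sum_centeredSegment hKc θ r s) (hr j), Finset.sum_insert hj,
      add_comm (ENNReal.ofReal _ * shadowVolume _ W), ← add_assoc]
    gcongr
    · exact ih hW'
    · exact shadowVolume_mono _ hW'

end Shadow

lemma le_mul_of_add_mul_le_one_add_pow {n : ℕ} {x y : ℝ}
    (h : ∀ t : ℝ, 0 < t → x + t * y ≤ (1 + t) ^ n * x) : y ≤ n * x := by
  have hd : HasDerivAt (fun t : ℝ => (1 + t) ^ n * x) (n * x) 0 := by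
    have := (((hasDerivAt_id (0 : ℝ)).const_add 1).pow n).mul_const x
    simpa using this
  have ht := (hasDerivAt_iff_tendsto_slope.1 hd).mono_left
    (nhdsWithin_mono (0 : ℝ) (s := Set.Ioi 0) fun t ht => ne_of_gt ht)
  refine ge_of_tendsto ht ?_
  filter_upwards [self_mem_nhdsWithin] with t ht
  have ht : 0 < t := ht
  rw [slope_def_field, le_div_iff₀ (by linarith)]
  have := h t ht
  simp only [add_zero, one_pow, sub_zero]
  linarith

lemma mul_le_of_one_add_pow_mul_le {n k : ℕ} {x y R : ℝ} (hx : 0 ≤ x)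
    (h : ∀ t : ℝ, 0 < t → (1 + t) ^ n * x ≤ x + t * (y * (1 + t * R) ^ k)) : n * x ≤ y := by
  have hc : Continuous fun t : ℝ => y * (1 + t * R) ^ k := by fun_prop
  have ht := (hc.tendsto 0).mono_left (nhdsWithin_le_nhds (s := Set.Ioi 0))
  simp only [zero_mul, add_zero, one_pow, mul_one] at ht
  refine ge_of_tendsto ht ?_
  filter_upwards [self_mem_nhdsWithin] with t ht
  have ht : 0 < t := ht
  have h1 := mul_le_mul_of_nonneg_right
    (one_add_mul_le_pow (show (-2 : ℝ) ≤ t by linarith) n) hx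
  have h2 := h t ht
  refine le_of_mul_le_mul_left ?_ ht
  linarith

section Zonotope

variable {n : ℕ}

/-- The Brunn–Minkowski inequality for two bodies of equal volume. -/
lemma EuclideanSpace.one_add_pow_mul_volume_le {A B : Set (EuclideanSpace ℝ (Fin n))}
    (hA : IsCompact A) (hB : IsCompact B) (hAB : volume A = volume B) {t : ℝ} (ht : 0 < t) :
    ENNReal.ofReal ((1 + t) ^ n) * volume A ≤ volume (A + t • B) := by
  have h1 : 0 < 1 + t := by linarith
  have hab : (1 + t)⁻¹ + t / (1 + t) = 1 := by field_simp
  have h := EuclideanSpace.volume_rpow_mul_volume_rpow_le (inv_pos.2 h1) (div_pos ht h1) hab hA hB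
  rw [← hAB, ← ENNReal.rpow_add_of_nonneg _ _ (inv_pos.2 h1).le (div_pos ht h1).le, hab,
    ENNReal.rpow_one] at h
  have hs : A + t • B = (1 + t) • ((1 + t)⁻¹ • A + (t / (1 + t)) • B) := by
    rw [smul_add, smul_smul, smul_smul, mul_inv_cancel₀ h1.ne', mul_div_cancel₀ _ h1.ne', one_smul]
  rw [hs, Measure.addHaar_smul_of_nonneg _ h1.le, finrank_euclideanSpace_fin]
  gcongr

lemma smul_sum_centeredSegment {V ι : Type*} [NormedAddCommGroup V] [InnerProductSpace ℝ V]
    (θ : ι → V) {r : ι → ℝ} (hr : ∀ i, 0 ≤ r i) {t : ℝ} (ht : 0 ≤ t) (s : Finset ι) :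
    t • ∑ i ∈ s, centeredSegment (θ i) (r i) = ∑ i ∈ s, centeredSegment (θ i) (t * r i) := by
  rw [Finset.smul_sum]
  exact Finset.sum_congr rfl fun i _ => smul_centeredSegment _ (hr i) ht

lemma sum_ofReal_mul_toReal {ι : Type*} {s : Finset ι} {r : ι → ℝ} (hr : ∀ i, 0 ≤ r i)
    {S : ι → ℝ≥0∞} (hS : ∀ i, S i ≠ ∞) :
    ∑ i ∈ s, ENNReal.ofReal (r i) * S i = ENNReal.ofReal (∑ i ∈ s, r i * (S i).toReal) := by
  rw [ENNReal.ofReal_sum_of_nonneg fun i _ => mul_nonneg (hr i) ENNReal.toReal_nonneg]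
  refine Finset.sum_congr rfl fun i _ => ?_
  rw [ENNReal.ofReal_mul (hr i), ENNReal.ofReal_toReal (hS i)]

variable {ι : Type*} [Fintype ι] {θ : ι → EuclideanSpace ℝ (Fin n)} {r : ι → ℝ}

/-- The mixed volume of a convex body with a zonotope it contains is at most its volume. -/
lemma Convex.sum_mul_shadowVolume_le {C : Set (EuclideanSpace ℝ (Fin n))} (hC : Convex ℝ C)
    (hCc : IsCompact C) (hθ : ∀ i, ‖θ i‖ = 1) (hr : ∀ i, 0 ≤ r i)
    (hZ : ∑ i, centeredSegment (θ i) (r i) ⊆ C) :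
    2 * ∑ i, r i * (shadowVolume (θ i) C).toReal ≤ n * (volume C).toReal := by
  refine le_mul_of_add_mul_le_one_add_pow fun t ht => ?_
  have hS : ∀ i, shadowVolume (θ i) C ≠ ∞ := fun i => hCc.shadowVolume_ne_top (hθ i)
  have hVt : volume C ≠ ∞ := hCc.measure_lt_top.ne
  have h := hC.le_volume_add_sum_centeredSegment hCc hθ (r := fun i => t * r i)
    (fun i => mul_nonneg ht.le (hr i)) Finset.univ
  rw [← smul_sum_centeredSegment θ hr ht.le] at h
  have h2 : volume (C + t • ∑ i, centeredSegment (θ i) (r i))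
      ≤ ENNReal.ofReal ((1 + t) ^ n) * volume C := by
    calc _ ≤ volume ((1 : ℝ) • C + t • C) := by
          rw [one_smul]
          exact measure_mono (Set.add_subset_add_left (Set.smul_set_mono hZ))
      _ = _ := by
          rw [← hC.add_smul zero_le_one ht.le, Measure.addHaar_smul_of_nonneg _ (by linarith),
            finrank_euclideanSpace_fin]
  have h3 := h.trans h2
  rw [sum_ofReal_mul_toReal (fun i => by have := hr i; positivity) hS,
    ← ENNReal.ofReal_toReal hVt, ← ENNReal.ofReal_add ENNReal.toReal_nonneg
      (Finset.sum_nonneg fun i _ => by have := hr i; positivity),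
    ← ENNReal.ofReal_mul (by positivity), ENNReal.ofReal_le_ofReal_iff (by positivity)] at h3
  refine le_trans (le_of_eq ?_) h3
  rw [Finset.mul_sum, Finset.mul_sum]
  congr 1
  exact Finset.sum_congr rfl fun i _ => by ring

lemma Convex.add_smul_subset_homothety_image {V : Type*} [NormedAddCommGroup V] [NormedSpace ℝ V]
    {D B : Set V} (hD : Convex ℝ D) {x : V} (hx : x ∈ interior D) (hB : Bornology.IsBounded B) :
    ∃ R : ℝ, 0 < R ∧ ∀ t : ℝ, 0 < t → D + t • B ⊆ AffineMap.homothety x (1 + t * R) '' D := by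
  obtain ⟨ε, hε, hball⟩ := Metric.isOpen_iff.1 isOpen_interior x hx
  obtain ⟨M, hM, hBM⟩ := hB.exists_pos_norm_lt
  have hR : 0 < M / ε := div_pos hM hε
  refine ⟨M / ε, hR, fun t ht => ?_⟩
  rintro _ ⟨d, hd, _, ⟨z, hz, rfl⟩, rfl⟩
  set R := M / ε with hRdef
  have h1 : 0 < 1 + t * R := by positivity
  have hw : x + R⁻¹ • z ∈ D := by
    refine interior_subset (hball ?_)
    rw [mem_ball_iff_norm, add_sub_cancel_left, norm_smul, Real.norm_of_nonneg (by positivity),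
      hRdef, inv_div, div_mul_eq_mul_div, div_lt_iff₀ hM]
    exact mul_lt_mul_of_pos_left (hBM z hz) hε
  refine ⟨(1 + t * R)⁻¹ • d + (t * R / (1 + t * R)) • (x + R⁻¹ • z),
    hD hd hw (by positivity) (by positivity) (by field_simp), ?_⟩
  simp only [AffineMap.homothety_apply, vsub_eq_sub, vadd_eq_add]
  match_scalars <;> field_simp
  ring

/-- Minkowski's first inequality for a convex body and a zonotope of the same volume. -/
lemma Convex.mul_volume_le_sum_mul_shadowVolume {D : Set (EuclideanSpace ℝ (Fin n))}
    (hD : Convex ℝ D) (hDc : IsCompact D) (hDi : (interior D).Nonempty) (hθ : ∀ i, ‖θ i‖ = 1)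
    (hr : ∀ i, 0 ≤ r i) (hv : volume D = volume (∑ i, centeredSegment (θ i) (r i))) :
    n * (volume D).toReal ≤ 2 * ∑ i, r i * (shadowVolume (θ i) D).toReal := by
  obtain ⟨x, hx⟩ := hDi
  have hZc : IsCompact (∑ i, centeredSegment (θ i) (r i)) := by
    have := isCompact_add_sum_centeredSegment (isCompact_singleton (x := 0)) θ r Finset.univ
    rwa [Set.singleton_zero, zero_add] at this
  obtain ⟨R, hR, hsub⟩ := hD.add_smul_subset_homothety_image hx hZc.isBounded
  refine mul_le_of_one_add_pow_mul_le (k := n - 1) (R := R) ENNReal.toReal_nonneg fun t ht => ?_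
  have hS : ∀ i, shadowVolume (θ i) D ≠ ∞ := fun i => hDc.shadowVolume_ne_top (hθ i)
  have hVt : volume D ≠ ∞ := hDc.measure_lt_top.ne
  have h := EuclideanSpace.one_add_pow_mul_volume_le hDc hZc hv ht
  have hsub' := hsub t ht
  rw [smul_sum_centeredSegment θ hr ht.le] at h hsub'
  have h2 := h.trans (hD.volume_add_sum_centeredSegment_le hDc hθ
    (fun i => mul_nonneg ht.le (hr i)) Finset.univ hsub')
  have h1 : 0 < 1 + t * R := by positivity
  simp only [shadowVolume_homothety_image _ _ h1, finrank_euclideanSpace_fin] at h2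
  rw [sum_ofReal_mul_toReal (fun i => by have := hr i; positivity)
      (fun i => ENNReal.mul_ne_top ENNReal.ofReal_ne_top (hS i)),
    ← ENNReal.ofReal_toReal hVt, ← ENNReal.ofReal_add ENNReal.toReal_nonneg
      (Finset.sum_nonneg fun i _ => by have := hr i; positivity),
    ← ENNReal.ofReal_mul (by positivity), ENNReal.ofReal_le_ofReal_iff
      (add_nonneg ENNReal.toReal_nonneg
      (Finset.sum_nonneg fun i _ => by have := hr i; positivity))] at h2
  refine h2.trans (le_of_eq ?_)
  rw [Finset.mul_sum, Finset.sum_mul, Finset.mul_sum]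
  congr 1
  refine Finset.sum_congr rfl fun i _ => ?_
  rw [ENNReal.toReal_mul, ENNReal.toReal_ofReal (by positivity)]
  ring

lemma sum_centeredSegment_eq {V : Type*} [NormedAddCommGroup V] [InnerProductSpace ℝ V]
    (θ : ι → V) {r : ι → ℝ} (hr : ∀ i, 0 < r i) :
    ∑ i, centeredSegment (θ i) (r i)
      = {x | ∃ lam : ι → ℝ, (∀ i, |lam i| ≤ 1) ∧ x = ∑ i, (r i * lam i) • θ i} := by
  ext x
  rw [Set.mem_fintype_sum]
  constructor
  · rintro ⟨g, hg, rfl⟩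
    choose c hc hcg using hg
    refine ⟨fun i => c i / r i, fun i => ?_, Finset.sum_congr rfl fun i _ => ?_⟩
    · rw [abs_div, abs_of_pos (hr i), div_le_one (hr i)]
      exact abs_le.2 (hc i)
    · rw [mul_div_cancel₀ _ (hr i).ne']
      exact (hcg i).symm
  · rintro ⟨l, hl, rfl⟩
    refine ⟨fun i => (r i * l i) • θ i, fun i => ⟨r i * l i, abs_le.1 ?_, rfl⟩, rfl⟩
    rw [abs_mul, abs_of_pos (hr i)]
    exact mul_le_of_le_one_right (hr i).le (hl i)

end Zonotope

lemma shadowVolume_le_of_hausdorffMeasure_le {n : ℕ} (hn : 1 ≤ n)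
    {C D : Set (EuclideanSpace ℝ (Fin n))} {θ : EuclideanSpace ℝ (Fin n)}
    (h : μH[(n : ℝ) - 1] ((fun x => x - ⟪θ, x⟫ • θ) '' D) ≤
      μH[(n : ℝ) - 1] ((fun x => x - ⟪θ, x⟫ • θ) '' C)) :
    shadowVolume θ D ≤ shadowVolume θ C := by
  have e : (n : ℝ) - 1 = ((n - 1 : ℕ) : ℝ) := by rw [Nat.cast_sub hn, Nat.cast_one]
  rw [e] at h
  rw [shadowVolume, shadowVolume, Measure.euclideanHausdorffMeasure_def, Measure.smul_apply,
    Measure.smul_apply, finrank_euclideanSpace_fin]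
  gcongr

lemma ENNReal.le_div_rpow_mul_of_pow_mul_le {k : ℕ} (hk : k ≠ 0) {c d z : ℝ≥0∞} (hz0 : z ≠ 0)
    (hzt : z ≠ ∞) (h : d ^ k * z ≤ c ^ (k + 1)) : d ≤ (c / z) ^ (1 / (k : ℝ)) * c := by
  have hk' : (0 : ℝ) < k := by positivity
  have h1 : d ^ k ≤ ((c / z) ^ (1 / (k : ℝ)) * c) ^ k := by
    rw [mul_pow, ← ENNReal.rpow_natCast ((c / z) ^ _), ← ENNReal.rpow_mul,
      one_div_mul_cancel hk'.ne', ENNReal.rpow_one, div_eq_mul_inv, mul_right_comm, ← pow_succ',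
      ← div_eq_mul_inv]
    exact (ENNReal.le_div_iff_mul_le (Or.inl hz0) (Or.inl hzt)).2 h
  exact (ENNReal.pow_right_strictMono hk).le_iff_le.1 h1

/-- If `C` and `D` are convex bodies in `ℝⁿ` (`n ≥ 2`) with `|P_θ D| ≤ |P_θ C|` for all
unit vectors `θ`, and `Z = ∑ i, α i • [-u i, u i]` is a zonotope contained in `C`, then
`|D| ≤ (|C| / |Z|)^{1/(n-1)} * |C|`. -/
theorem stmt_13 (n m : ℕ) (hn : 2 ≤ n)
    (C D : Set (EuclideanSpace ℝ (Fin n)))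
    (hC : Convex ℝ C) (hCc : IsCompact C) (hCi : (interior C).Nonempty)
    (hD : Convex ℝ D) (hDc : IsCompact D) (hDi : (interior D).Nonempty)
    (hshadow : ∀ θ : EuclideanSpace ℝ (Fin n), ‖θ‖ = 1 →
      μH[(n : ℝ) - 1] ((fun x => x - ⟪θ, x⟫ • θ) '' D) ≤
        μH[(n : ℝ) - 1] ((fun x => x - ⟪θ, x⟫ • θ) '' C))
    (u : Fin m → EuclideanSpace ℝ (Fin n)) (α : Fin m → ℝ)
    (hu : ∀ i, ‖u i‖ = 1) (hα : ∀ i, 0 < α i)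
    (Z : Set (EuclideanSpace ℝ (Fin n)))
    (hZ : Z = {x : EuclideanSpace ℝ (Fin n) | ∃ lam : Fin m → ℝ,
      (∀ i, |lam i| ≤ 1) ∧ x = ∑ i, (α i * lam i) • u i})
    (hZC : Z ⊆ C) :
    volume D ≤ (volume C / volume Z) ^ ((1 : ℝ) / ((n : ℝ) - 1)) * volume C := by
  obtain ⟨k, rfl⟩ : ∃ k, n = k + 1 := ⟨n - 1, by omega⟩
  have hk : k ≠ 0 := by omega
  rw [← sum_centeredSegment_eq u hα] at hZ
  have hCt : volume C ≠ ∞ := hCc.measure_lt_top.ne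
  have hDt : volume D ≠ ∞ := hDc.measure_lt_top.ne
  have hZt : volume Z ≠ ∞ := ((measure_mono hZC).trans_lt hCc.measure_lt_top).ne
  have hC0 : volume C ≠ 0 := (Measure.measure_pos_of_nonempty_interior _ hCi).ne'
  have hD0 : volume D ≠ 0 := (Measure.measure_pos_of_nonempty_interior _ hDi).ne'
  have hkn : ((k + 1 : ℕ) : ℝ) - 1 = k := by push_cast; ring
  rw [hkn]
  rcases eq_or_ne (volume Z) 0 with hZ0 | hZ0
  · have : (0 : ℝ) < 1 / k := by positivity
    rw [hZ0, ENNReal.div_zero hC0, ENNReal.top_rpow_of_pos this, ENNReal.top_mul hC0]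
    exact le_top
  refine ENNReal.le_div_rpow_mul_of_pow_mul_le hk hZ0 hZt ?_
  have hdpos : 0 < (volume D).toReal := ENNReal.toReal_pos hD0 hDt
  have hzpos : 0 < (volume Z).toReal := ENNReal.toReal_pos hZ0 hZt
  obtain ⟨c, hc, hcn⟩ : ∃ c : ℝ, 0 < c ∧ c ^ (k + 1) = (volume D).toReal / (volume Z).toReal :=
    ⟨((volume D).toReal / (volume Z).toReal) ^ (((k + 1 : ℕ) : ℝ)⁻¹), by positivity,
      Real.rpow_inv_natCast_pow (by positivity) (by omega)⟩
  have hα' : ∀ i, 0 ≤ α i := fun i => (hα i).le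
  have hv : volume D = volume (∑ i, centeredSegment (u i) (c * α i)) := by
    rw [← smul_sum_centeredSegment u hα' hc.le, ← hZ, Measure.addHaar_smul_of_nonneg _ hc.le,
      finrank_euclideanSpace_fin, hcn, ← ENNReal.toReal_eq_toReal_iff' hDt
      (ENNReal.mul_ne_top ENNReal.ofReal_ne_top hZt), ENNReal.toReal_mul,
      ENNReal.toReal_ofReal (by positivity), div_mul_cancel₀ _ hzpos.ne']
  have h1 := hD.mul_volume_le_sum_mul_shadowVolume hDc hDi hu
    (fun i => mul_nonneg hc.le (hα' i)) hv
  have h2 := hC.sum_mul_shadowVolume_le hCc hu hα' (hZ ▸ hZC)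
  have h3 : ∑ i, c * α i * (shadowVolume (u i) D).toReal
      ≤ c * ∑ i, α i * (shadowVolume (u i) C).toReal := by
    rw [Finset.mul_sum]
    refine Finset.sum_le_sum fun i _ => ?_
    rw [mul_assoc]
    refine mul_le_mul_of_nonneg_left (mul_le_mul_of_nonneg_left ?_ (hα' i)) hc.le
    exact ENNReal.toReal_mono (hCc.shadowVolume_ne_top (hu i))
      (shadowVolume_le_of_hausdorffMeasure_le (by omega) (hshadow _ (hu i)))
  have h4 : (volume D).toReal ≤ c * (volume C).toReal := by
    have hpos : (0 : ℝ) < (k + 1 : ℕ) := by positivity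
    refine le_of_mul_le_mul_left ?_ hpos
    have := mul_le_mul_of_nonneg_left h2 hc.le
    linarith
  have h5 : (volume D).toReal ^ k * (volume Z).toReal ≤ (volume C).toReal ^ (k + 1) := by
    have h6 := pow_le_pow_left₀ hdpos.le h4 (k + 1)
    rw [mul_pow, hcn, div_mul_eq_mul_div, le_div_iff₀ hzpos, pow_succ'] at h6
    refine le_of_mul_le_mul_left ?_ hdpos
    linarith
  rw [← ENNReal.toReal_le_toReal (ENNReal.mul_ne_top (ENNReal.pow_ne_top hDt) hZt)
    (ENNReal.pow_ne_top hCt)]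
  simpa using h5
end

section
/- (Vaaler-type cube section bound, Lemma 8) Let (u_i)_{i=1}^m be unit vectors in R^n. Then the symmetric convex body K = {x ∈ R^n : |⟨x, u_i⟩| ≤ 1 for all 1 ≤ i ≤ m} satisfies |K|^{1/n} ≥ 2 √(n/m). -/
open MeasureTheory
open scoped RealInnerProductSpace BigOperators

open scoped Pointwise in
theorem IsCompact.volume_add_volume_le {A B : Set ℝ} (hA : IsCompact A) (hB : IsCompact B)
    (hA' : A.Nonempty) (hB' : B.Nonempty) : volume A + volume B ≤ volume (A + B) := by
  obtain ⟨p, hpA, hp⟩ := hA.exists_isGreatest hA'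
  obtain ⟨q, hqB, hq⟩ := hB.exists_isLeast hB'
  have hinter : (A + {q}) ∩ ({p} + B) ⊆ {p + q} := by
    rintro x ⟨⟨a, ha, _, rfl, rfl⟩, ⟨_, rfl, b, hb, hab⟩⟩
    have h1 := hp ha
    have h2 := hq hb
    simp only [Set.mem_singleton_iff] at hab ⊢
    linarith
  have hdisj : AEDisjoint volume (A + {q}) ({p} + B) :=
    measure_mono_null hinter (measure_singleton _)
  have hmeas : MeasurableSet ({p} + B) := (isCompact_singleton.add hB).measurableSet
  calc volume A + volume B = volume (A + {q}) + volume ({p} + B) := by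
        simp [Set.add_singleton, Set.singleton_add]
    _ = volume ((A + {q}) ∪ ({p} + B)) := (measure_union₀ hmeas.nullMeasurableSet hdisj).symm
    _ ≤ volume (A + B) := by
        gcongr
        exact Set.union_subset (Set.add_subset_add_left (by simpa))
          (Set.add_subset_add_right (by simpa))

open scoped Pointwise in
/-- The one-dimensional Brunn–Minkowski inequality. -/
theorem Real.volume_add_volume_le {A B : Set ℝ} (hA : MeasurableSet A) (hB : MeasurableSet B)
    (hA' : A.Nonempty) (hB' : B.Nonempty) : volume A + volume B ≤ volume (A + B) := by
  obtain ⟨a, ha⟩ := hA'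
  obtain ⟨b, hb⟩ := hB'
  rw [hA.measure_eq_iSup_isCompact, hB.measure_eq_iSup_isCompact]
  simp only [iSup_and']
  refine ENNReal.biSup_add_biSup_le' ⟨∅, by simp⟩ ⟨∅, by simp⟩ ?_
  rintro K ⟨hKA, hK⟩ L ⟨hLB, hL⟩
  calc volume K + volume L ≤ volume (insert a K) + volume (insert b L) := by
        gcongr <;> exact Set.subset_insert _ _
    _ ≤ volume (insert a K + insert b L) :=
        (hK.insert a).volume_add_volume_le (hL.insert b) (Set.insert_nonempty _ _)
          (Set.insert_nonempty _ _)
    _ ≤ volume (A + B) := by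
        gcongr
        · exact Set.insert_subset ha hKA
        · exact Set.insert_subset hb hLB

theorem ENNReal.geom_mean_le_arith_mean2_weighted {a b : ℝ} (ha : 0 < a) (hb : 0 < b)
    (hab : a + b = 1) (x y : ENNReal) :
    x ^ a * y ^ b ≤ ENNReal.ofReal a * x + ENNReal.ofReal b * y := by
  rcases eq_or_ne x ⊤ with rfl | hx
  · simp [ENNReal.mul_top, ha]
  rcases eq_or_ne y ⊤ with rfl | hy
  · simp [ENNReal.mul_top, hb]
  lift x to NNReal using hx
  lift y to NNReal using hy
  rw [← ENNReal.coe_rpow_of_nonneg _ ha.le, ← ENNReal.coe_rpow_of_nonneg _ hb.le,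
    ENNReal.ofReal, ENNReal.ofReal]
  norm_cast
  have := NNReal.geom_mean_le_arith_mean2_weighted a.toNNReal b.toNNReal x y
    (by rw [← Real.toNNReal_add ha.le hb.le, hab, Real.toNNReal_one])
  simpa [ha.le, hb.le] using this

theorem lintegral_eq_lintegral_volume_lt {φ : ℝ → ENNReal} (hφ : Measurable φ)
    (hφ' : ∀ x, φ x ≠ ⊤) :
    ∫⁻ x, φ x = ∫⁻ t in Set.Ioi (0 : ℝ), volume {x | ENNReal.ofReal t < φ x} := by
  have h := lintegral_eq_lintegral_meas_lt (f := fun x => (φ x).toReal) volume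
    (Filter.Eventually.of_forall fun x => ENNReal.toReal_nonneg) hφ.ennreal_toReal.aemeasurable
  simp only [ENNReal.ofReal_toReal (hφ' _)] at h
  rw [h]
  refine setLIntegral_congr_fun measurableSet_Ioi fun t ht => ?_
  simp only [ENNReal.ofReal_lt_iff_lt_toReal (le_of_lt ht) (hφ' _)]

open scoped Pointwise in
theorem add_lintegral_le_of_iSup_eq_one {a b : ℝ} (ha : 0 < a) (hb : 0 < b) (hab : a + b = 1)
    {f g h : ℝ → ENNReal} (hf : Measurable f) (hg : Measurable g) (hh : Measurable h)
    (hf1 : ⨆ x, f x = 1) (hg1 : ⨆ x, g x = 1)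
    (H : ∀ x y, f x ^ a * g y ^ b ≤ h (a * x + b * y)) :
    ENNReal.ofReal a * (∫⁻ x, f x) + ENNReal.ofReal b * (∫⁻ x, g x) ≤ ∫⁻ x, h x := by
  have hfle : ∀ x, f x ≤ 1 := fun x => hf1 ▸ le_iSup f x
  have hgle : ∀ x, g x ≤ 1 := fun x => hg1 ▸ le_iSup g x
  have anti : ∀ φ : ℝ → ENNReal, Measurable fun t : ℝ => volume {x | ENNReal.ofReal t < φ x} :=
    fun φ => Antitone.measurable fun s t hst => measure_mono fun x hx =>
      (ENNReal.ofReal_le_ofReal hst).trans_lt hx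
  have hmeas : ∀ {φ : ℝ → ENNReal}, Measurable φ → ∀ t : ℝ,
      MeasurableSet {x | ENNReal.ofReal t < φ x} := fun hφ t => measurableSet_lt measurable_const hφ
  have hmin : Measurable fun x => min (h x) 1 := hh.min measurable_const
  refine le_trans ?_ (lintegral_mono fun x => min_le_left (h x) 1)
  rw [lintegral_eq_lintegral_volume_lt hf fun x => ne_top_of_le_ne_top ENNReal.one_ne_top (hfle x),
    lintegral_eq_lintegral_volume_lt hg fun x => ne_top_of_le_ne_top ENNReal.one_ne_top (hgle x),
    lintegral_eq_lintegral_volume_lt hmin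
      fun x => ne_top_of_le_ne_top ENNReal.one_ne_top (min_le_right _ _),
    ← lintegral_const_mul _ (anti f), ← lintegral_const_mul _ (anti g),
    ← lintegral_add_left ((anti f).const_mul _)]
  refine setLIntegral_mono (anti _) fun t ht => ?_
  rcases le_or_gt 1 t with h1 | h1
  · have h1' : (1 : ENNReal) ≤ ENNReal.ofReal t := by simpa using h1
    simp [fun x => ((hfle x).trans h1').not_gt, fun x => ((hgle x).trans h1').not_gt]
  have h1' : ENNReal.ofReal t < 1 := by simpa using h1
  obtain ⟨x₀, hx₀⟩ := lt_iSup_iff.1 (hf1 ▸ h1')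
  obtain ⟨y₀, hy₀⟩ := lt_iSup_iff.1 (hg1 ▸ h1')
  have hvol : ∀ {c : ℝ}, 0 < c → ∀ s : Set ℝ, ENNReal.ofReal c * volume s = volume (c • s) := by
    intro c hc s
    simp [Measure.addHaar_smul, abs_of_pos hc]
  rw [hvol ha, hvol hb]
  refine (Real.volume_add_volume_le ((hmeas hf t).const_smul₀ a) ((hmeas hg t).const_smul₀ b)
    (Set.Nonempty.smul_set ⟨x₀, hx₀⟩) (Set.Nonempty.smul_set ⟨y₀, hy₀⟩)).trans (measure_mono ?_)
  rintro _ ⟨_, ⟨x, hx, rfl⟩, _, ⟨y, hy, rfl⟩, rfl⟩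
  refine lt_min (lt_of_lt_of_le ?_ (H x y)) h1'
  have ht0 : ENNReal.ofReal t ≠ 0 := by simpa using ht
  calc ENNReal.ofReal t = ENNReal.ofReal t ^ a * ENNReal.ofReal t ^ b := by
        rw [← ENNReal.rpow_add _ _ ht0 ENNReal.ofReal_ne_top, hab, ENNReal.rpow_one]
    _ < f x ^ a * g y ^ b :=
        ENNReal.mul_lt_mul (ENNReal.rpow_lt_rpow hx ha) (ENNReal.rpow_lt_rpow hy hb)

theorem prekopa_leindler_real_of_bounded {a b : ℝ} (ha : 0 < a) (hb : 0 < b) (hab : a + b = 1)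
    {f g h : ℝ → ENNReal} (hf : Measurable f) (hg : Measurable g) (hh : Measurable h)
    (hf' : ⨆ x, f x ≠ ⊤) (hg' : ⨆ x, g x ≠ ⊤)
    (H : ∀ x y, f x ^ a * g y ^ b ≤ h (a * x + b * y)) :
    (∫⁻ x, f x) ^ a * (∫⁻ x, g x) ^ b ≤ ∫⁻ x, h x := by
  set M := ⨆ x, f x with hM
  set P := ⨆ x, g x with hP
  rcases eq_or_ne M 0 with hM0 | hM0
  · have : ∀ x, f x = 0 := fun x => le_zero_iff.1 (hM0 ▸ le_iSup f x)
    simp [this, ha]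
  rcases eq_or_ne P 0 with hP0 | hP0
  · have : ∀ x, g x = 0 := fun x => le_zero_iff.1 (hP0 ▸ le_iSup g x)
    simp [this, hb]
  have hMa0 : M ^ a ≠ 0 := by simp [ENNReal.rpow_eq_zero_iff, hM0, hf']
  have hPb0 : P ^ b ≠ 0 := by simp [ENNReal.rpow_eq_zero_iff, hP0, hg']
  have hMat : M ^ a ≠ ⊤ := ENNReal.rpow_ne_top_of_nonneg ha.le hf'
  have hPbt : P ^ b ≠ ⊤ := ENNReal.rpow_ne_top_of_nonneg hb.le hg'
  have key := add_lintegral_le_of_iSup_eq_one ha hb hab (hf.const_mul M⁻¹) (hg.const_mul P⁻¹)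
    (hh.const_mul ((M ^ a)⁻¹ * (P ^ b)⁻¹))
    (by rw [← ENNReal.mul_iSup, ENNReal.inv_mul_cancel hM0 hf'])
    (by rw [← ENNReal.mul_iSup, ENNReal.inv_mul_cancel hP0 hg'])
    (fun x y => by
      rw [ENNReal.mul_rpow_of_nonneg _ _ ha.le, ENNReal.mul_rpow_of_nonneg _ _ hb.le,
        ENNReal.inv_rpow, ENNReal.inv_rpow, mul_mul_mul_comm]
      gcongr
      exact H x y)
  rw [lintegral_const_mul _ hf, lintegral_const_mul _ hg, lintegral_const_mul _ hh] at key
  have key2 := (ENNReal.geom_mean_le_arith_mean2_weighted ha hb hab _ _).trans key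
  rw [ENNReal.mul_rpow_of_nonneg _ _ ha.le, ENNReal.mul_rpow_of_nonneg _ _ hb.le,
    ENNReal.inv_rpow, ENNReal.inv_rpow, mul_mul_mul_comm] at key2
  refine (ENNReal.mul_le_mul_iff_right ?_ ?_).1 key2
  · simp [hMat, hPbt]
  · exact ENNReal.mul_ne_top (by simp [hMa0]) (by simp [hPb0])

/-- The one-dimensional Prékopa–Leindler inequality. -/
theorem prekopa_leindler_real {a b : ℝ} (ha : 0 < a) (hb : 0 < b) (hab : a + b = 1)
    {f g h : ℝ → ENNReal} (hf : Measurable f) (hg : Measurable g) (hh : Measurable h)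
    (H : ∀ x y, f x ^ a * g y ^ b ≤ h (a * x + b * y)) :
    (∫⁻ x, f x) ^ a * (∫⁻ x, g x) ^ b ≤ ∫⁻ x, h x := by
  rcases eq_or_ne (∫⁻ x, f x) 0 with hf0 | hf0
  · simp [hf0, ha]
  rcases eq_or_ne (∫⁻ x, g x) 0 with hg0 | hg0
  · simp [hg0, hb]
  have trunc : ∀ {φ : ℝ → ENNReal}, Measurable φ → Filter.Tendsto
      (fun N : ℕ => ∫⁻ x, min (φ x) N) Filter.atTop (nhds (∫⁻ x, φ x)) := by
    intro φ hφ
    refine lintegral_tendsto_of_tendsto_of_monotone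
      (fun N => (hφ.min measurable_const).aemeasurable)
      (Filter.Eventually.of_forall fun x i j hij => by dsimp only; gcongr)
      (Filter.Eventually.of_forall fun x => ?_)
    simpa using (tendsto_const_nhds (x := φ x)).min ENNReal.tendsto_nat_nhds_top
  have lim := ENNReal.Tendsto.mul ((trunc hf).ennrpow_const a)
    (Or.inl (by simp [ENNReal.rpow_eq_zero_iff, hf0, ha, ha.le])) ((trunc hg).ennrpow_const b)
    (Or.inl (by simp [ENNReal.rpow_eq_zero_iff, hg0, hb, hb.le]))
  refine le_of_tendsto' lim fun N => ?_
  have bdd : ∀ φ : ℝ → ENNReal, ⨆ x, min (φ x) N ≠ ⊤ := fun φ =>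
    ne_top_of_le_ne_top (ENNReal.natCast_ne_top N) (iSup_le fun x => min_le_right _ _)
  exact prekopa_leindler_real_of_bounded ha hb hab (hf.min measurable_const)
    (hg.min measurable_const) hh (bdd f) (bdd g) fun x y => (H x y).trans' <| by
      gcongr <;> exact min_le_left _ _

/-- The Prékopa–Leindler inequality. -/
theorem prekopa_leindler {a b : ℝ} (ha : 0 < a) (hb : 0 < b) (hab : a + b = 1) (k : ℕ)
    {f g h : (Fin k → ℝ) → ENNReal} (hf : Measurable f) (hg : Measurable g) (hh : Measurable h)
    (H : ∀ x y, f x ^ a * g y ^ b ≤ h (a • x + b • y)) :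
    (∫⁻ x, f x) ^ a * (∫⁻ x, g x) ^ b ≤ ∫⁻ x, h x := by
  induction k with
  | zero =>
    have h0 : ∀ φ : (Fin 0 → ℝ) → ENNReal, ∫⁻ x, φ x = φ 0 := by
      intro φ
      rw [Measure.volume_pi_eq_dirac 0, lintegral_dirac]
    simpa [h0] using H 0 0
  | succ k ih =>
    let e := MeasurableEquiv.piFinSuccAbove (fun _ : Fin (k + 1) => ℝ) 0
    have hm : ∀ {φ : (Fin (k + 1) → ℝ) → ENNReal}, Measurable φ →
        Measurable fun p : ℝ × (Fin k → ℝ) => φ (e.symm p) := fun hφ => hφ.comp e.symm.measurable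
    have fub : ∀ {φ : (Fin (k + 1) → ℝ) → ENNReal}, Measurable φ →
        ∫⁻ x, φ x = ∫⁻ s, ∫⁻ y, φ (e.symm (s, y)) := by
      intro φ hφ
      rw [← lintegral_prod _ (hm hφ).aemeasurable]
      exact ((volume_preserving_piFinSuccAbove (fun _ => ℝ) 0).symm e).lintegral_comp hφ |>.symm
    have hsec : ∀ {φ : (Fin (k + 1) → ℝ) → ENNReal}, Measurable φ → ∀ s : ℝ,
        Measurable fun y => φ (e.symm (s, y)) := fun hφ s => (hm hφ).comp measurable_prodMk_left
    rw [fub hf, fub hg, fub hh]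
    refine prekopa_leindler_real ha hb hab (hm hf).lintegral_prod_right'
      (hm hg).lintegral_prod_right' (hm hh).lintegral_prod_right' fun s t => ?_
    refine ih (hsec hf s) (hsec hg t) (hsec hh _) fun x y => (H _ _).trans_eq ?_
    congr 1
    ext i
    refine Fin.cases ?_ (fun j => ?_) i <;> simp [e, MeasurableEquiv.piFinSuccAbove]

/-- An extended nonnegative function is log-concave when its value at a convex combination is at
least the corresponding weighted geometric mean of its values. -/
def ENNLogConcave {E : Type*} [AddCommGroup E] [Module ℝ E] (f : E → ENNReal) : Prop :=
  ∀ ⦃a b : ℝ⦄, 0 < a → 0 < b → a + b = 1 → ∀ x y, f x ^ a * f y ^ b ≤ f (a • x + b • y)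

namespace ENNLogConcave

variable {E : Type*} [AddCommGroup E] [Module ℝ E]

theorem mul {f g : E → ENNReal} (hf : ENNLogConcave f) (hg : ENNLogConcave g) :
    ENNLogConcave fun x => f x * g x := by
  intro a b ha hb hab x y
  dsimp only
  rw [ENNReal.mul_rpow_of_nonneg _ _ ha.le, ENNReal.mul_rpow_of_nonneg _ _ hb.le, mul_mul_mul_comm]
  exact mul_le_mul' (hf ha hb hab x y) (hg ha hb hab x y)

theorem one : ENNLogConcave fun _ : E => (1 : ENNReal) := by
  intro a b _ _ _ x y
  simp

theorem prod {ι : Type*} (s : Finset ι) {f : ι → E → ENNReal} (hf : ∀ i, ENNLogConcave (f i)) :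
    ENNLogConcave fun x => ∏ i ∈ s, f i x := by
  classical
  induction s using Finset.induction_on with
  | empty => simpa using one
  | insert i s hi ih => simpa [Finset.prod_insert hi] using (hf i).mul ih

theorem comp_linearMap {F : Type*} [AddCommGroup F] [Module ℝ F] {f : F → ENNReal}
    (hf : ENNLogConcave f) (T : E →ₗ[ℝ] F) : ENNLogConcave fun x => f (T x) := by
  intro a b ha hb hab x y
  simpa using hf ha hb hab (T x) (T y)

theorem indicator {s : Set E} (hs : Convex ℝ s) : ENNLogConcave (s.indicator 1) := by
  intro a b ha hb hab x y
  by_cases hx : x ∈ s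
  · by_cases hy : y ∈ s
    · simp [hx, hy, hs hx hy ha.le hb.le hab]
    · simp [hy, hb]
  · simp [hx, ha]

theorem exp_neg_mul_sq {c : ℝ} (hc : 0 ≤ c) :
    ENNLogConcave fun t : ℝ => ENNReal.ofReal (Real.exp (-c * t ^ 2)) := by
  intro a b ha hb hab x y
  dsimp only
  rw [ENNReal.ofReal_rpow_of_pos (Real.exp_pos _), ENNReal.ofReal_rpow_of_pos (Real.exp_pos _),
    ← ENNReal.ofReal_mul (by positivity), ← Real.exp_mul, ← Real.exp_mul, ← Real.exp_add]
  refine ENNReal.ofReal_le_ofReal (Real.exp_le_exp.2 ?_)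
  obtain rfl : b = 1 - a := by linarith
  simp only [smul_eq_mul]
  nlinarith [mul_nonneg (mul_nonneg hc (mul_pos ha hb).le) (sq_nonneg (x - y))]

/-- The integrals of an even log-concave function over parallel slices decrease away from `0`. -/
theorem lintegral_slice_le {k : ℕ} {G : ℝ × (Fin k → ℝ) → ENNReal} (hG : ENNLogConcave G)
    (hm : Measurable G) (heven : ∀ p, G (-p) = G p) {s t : ℝ} (hst : |t| ≤ |s|) :
    ∫⁻ y, G (s, y) ≤ ∫⁻ y, G (t, y) := by
  have hneg : ∀ r : ℝ, ∫⁻ y, G (-r, y) = ∫⁻ y, G (r, y) := by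
    intro r
    rw [← lintegral_neg_eq_self fun y => G (-r, y)]
    refine lintegral_congr fun y => ?_
    rw [← heven (r, y), Prod.neg_mk]
  rcases eq_or_lt_of_le hst with h | h
  · rcases abs_eq_abs.1 h with rfl | rfl
    · rfl
    · rw [hneg]
  have hs : 0 < |s| := (abs_nonneg t).trans_lt h
  have hs' : s ≠ 0 := abs_pos.1 hs
  have hdiv : |t / s| < 1 := by rwa [abs_div, div_lt_one hs]
  obtain ⟨h1, h2⟩ := abs_lt.1 hdiv
  have ha : 0 < (1 + t / s) / 2 := by linarith
  have hb : 0 < (1 - t / s) / 2 := by linarith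
  have hab : (1 + t / s) / 2 + (1 - t / s) / 2 = 1 := by ring
  have hsec : ∀ r : ℝ, Measurable fun y => G (r, y) := fun r => hm.comp measurable_prodMk_left
  have key := prekopa_leindler ha hb hab k (hsec s) (hsec (-s)) (hsec t) fun x y => by
    refine (hG ha hb hab (s, x) (-s, y)).trans_eq ?_
    congr 1
    refine Prod.ext ?_ rfl
    simp only [Prod.smul_mk, Prod.mk_add_mk, smul_eq_mul]
    field_simp
    ring
  rwa [hneg, ← ENNReal.rpow_add_of_nonneg _ _ ha.le hb.le, hab, ENNReal.rpow_one] at key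

end ENNLogConcave

theorem lintegral_mul_le_lintegral_mul_indicator {h g : ℝ → ENNReal}
    (hg : Measurable g) (hanti : ∀ s t, |t| ≤ |s| → h s ≤ h t) (hg1 : ∀ t, g t ≤ 1)
    (hg2 : ∫⁻ t, g t = 2) :
    ∫⁻ t, h t * g t ≤ ∫⁻ t, h t * (Set.Icc (-1) 1).indicator 1 t := by
  have hI : Measurable ((Set.Icc (-1 : ℝ) 1).indicator (1 : ℝ → ENNReal)) :=
    measurable_one.indicator measurableSet_Icc
  have hI2 : ∫⁻ t, (Set.Icc (-1 : ℝ) 1).indicator (1 : ℝ → ENNReal) t = 2 := by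
    rw [lintegral_indicator_one measurableSet_Icc, Real.volume_Icc]
    norm_num
  have hle : ∀ t, h 1 * (Set.Icc (-1 : ℝ) 1).indicator 1 t ≤
      h t * (Set.Icc (-1 : ℝ) 1).indicator 1 t := by
    intro t
    by_cases ht : t ∈ Set.Icc (-1 : ℝ) 1
    · simpa [ht] using hanti 1 t (by simpa [abs_le] using ht)
    · simp [ht]
  rcases eq_or_ne (h 1) ⊤ with htop | htop
  · refine le_top.trans ((lintegral_mono hle).trans' ?_)
    rw [lintegral_const_mul _ hI, hI2, htop, ENNReal.top_mul two_ne_zero]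
  have hpt : ∀ t, h t * g t + h 1 * (Set.Icc (-1 : ℝ) 1).indicator 1 t ≤
      h t * (Set.Icc (-1 : ℝ) 1).indicator 1 t + h 1 * g t := by
    intro t
    by_cases ht : t ∈ Set.Icc (-1 : ℝ) 1
    · obtain ⟨d, hd⟩ := exists_add_of_le (hanti 1 t (by simpa [abs_le] using ht))
      simp only [ht, Set.indicator_of_mem, Pi.one_apply, mul_one]
      rw [hd, add_mul]
      calc h 1 * g t + d * g t + h 1 ≤ h 1 * g t + d * 1 + h 1 := by
            gcongr
            exact hg1 t
        _ = h 1 + d + h 1 * g t := by ring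
    · have : h t ≤ h 1 := hanti t 1 (by
        rw [abs_one]
        by_contra! hlt
        exact ht (abs_le.1 hlt.le))
      simpa [ht] using mul_le_mul_left this (g t)
  have := lintegral_mono (μ := volume) hpt
  rw [lintegral_add_right _ (hI.const_mul _), lintegral_add_right _ (hg.const_mul _),
    lintegral_const_mul _ hI, lintegral_const_mul _ hg, hg2, hI2] at this
  exact (ENNReal.add_le_add_iff_right (ENNReal.mul_ne_top htop ENNReal.ofNat_ne_top)).1 this

theorem exists_orthonormalBasis_apply_eq {n : ℕ} {u : EuclideanSpace ℝ (Fin n)} (hu : ‖u‖ = 1)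
    (i : Fin n) : ∃ b : OrthonormalBasis (Fin n) ℝ (EuclideanSpace ℝ (Fin n)), b i = u := by
  obtain ⟨b, hb⟩ := Orthonormal.exists_orthonormalBasis_extension_of_card_eq (𝕜 := ℝ)
    (ι := Fin n) (by simp) (v := fun _ => u) (s := {i})
    ⟨fun _ => hu, fun i j hij => (hij (Subsingleton.elim i j)).elim⟩
  exact ⟨b, hb i rfl⟩

theorem exists_measurePreserving_inner_eq_fst {k : ℕ} {u : EuclideanSpace ℝ (Fin (k + 1))}
    (hu : ‖u‖ = 1) :
    ∃ T : (ℝ × (Fin k → ℝ)) →ₗ[ℝ] EuclideanSpace ℝ (Fin (k + 1)),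
      MeasurePreserving T ∧ ∀ p, ⟪T p, u⟫ = p.1 := by
  obtain ⟨b, hb0⟩ := exists_orthonormalBasis_apply_eq hu 0
  let e := MeasurableEquiv.piFinSuccAbove (fun _ : Fin (k + 1) => ℝ) 0
  let C : (ℝ × (Fin k → ℝ)) →ₗ[ℝ] (Fin (k + 1) → ℝ) :=
    { toFun := fun p => Fin.cons p.1 p.2
      map_add' := fun p q => by ext i; refine Fin.cases ?_ (fun j => ?_) i <;> simp
      map_smul' := fun c p => by ext i; refine Fin.cases ?_ (fun j => ?_) i <;> simp }
  have hC : ⇑C = e.symm := by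
    ext p i
    refine Fin.cases ?_ (fun j => ?_) i <;> simp [C, e, MeasurableEquiv.piFinSuccAbove]
  refine ⟨b.repr.symm.toLinearEquiv.toLinearMap ∘ₗ
    (WithLp.linearEquiv 2 ℝ (Fin (k + 1) → ℝ)).symm.toLinearMap ∘ₗ C, ?_, fun p => ?_⟩
  · have h1 : MeasurePreserving C := by
      rw [hC]
      exact (volume_preserving_piFinSuccAbove (fun _ => ℝ) 0).symm e
    exact b.measurePreserving_repr_symm.comp ((PiLp.volume_preserving_toLp _).comp h1)
  · rw [← hb0, real_inner_comm, ← b.repr_apply_apply]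
    simp [C]

theorem lintegral_mul_gaussian_le_lintegral_mul_slab {n : ℕ}
    {F : EuclideanSpace ℝ (Fin n) → ENNReal} (hF : ENNLogConcave F) (hm : Measurable F)
    (heven : ∀ x, F (-x) = F x) {g : ℝ → ENNReal} (hg : Measurable g) (hg1 : ∀ t, g t ≤ 1)
    (hg2 : ∫⁻ t, g t = 2) {u : EuclideanSpace ℝ (Fin n)} (hu : ‖u‖ = 1) :
    ∫⁻ x, F x * g ⟪x, u⟫ ≤ ∫⁻ x, F x * (Set.Icc (-1) 1).indicator 1 ⟪x, u⟫ := by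
  cases n with
  | zero => simp [Subsingleton.elim u 0] at hu
  | succ k =>
    obtain ⟨T, hT, hTu⟩ := exists_measurePreserving_inner_eq_fst hu
    have hGm : Measurable fun p => F (T p) := hm.comp hT.measurable
    have fub : ∀ {ψ : ℝ → ENNReal}, Measurable ψ →
        ∫⁻ x, F x * ψ ⟪x, u⟫ = ∫⁻ s, (∫⁻ y, F (T (s, y))) * ψ s := by
      intro ψ hψ
      have hinner : Measurable fun x : EuclideanSpace ℝ (Fin (k + 1)) => ⟪x, u⟫ := by fun_prop
      refine (hT.lintegral_comp (f := fun x => F x * ψ ⟪x, u⟫)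
        (hm.mul (hψ.comp hinner))).symm.trans ?_
      simp only [hTu]
      refine (lintegral_prod (fun p => F (T p) * ψ p.1)
        (hGm.mul (hψ.comp measurable_fst)).aemeasurable).trans ?_
      exact lintegral_congr fun s => by
        have hs : Measurable fun y => F (T (s, y)) := hGm.comp measurable_prodMk_left
        exact lintegral_mul_const (ψ s) hs
    rw [fub hg, fub (measurable_one.indicator measurableSet_Icc)]
    exact lintegral_mul_le_lintegral_mul_indicator hg
      (fun s t hst => (hF.comp_linearMap T).lintegral_slice_le hGm
        (fun p => by rw [map_neg, heven]) hst) hg1 hg2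

theorem lintegral_mul_prod_gaussian_le {n : ℕ} {ι : Type*} (S : Finset ι)
    {u : ι → EuclideanSpace ℝ (Fin n)} (hu : ∀ i, ‖u i‖ = 1) {c : ℝ} (hc : 0 ≤ c)
    (hc2 : ∫⁻ t : ℝ, ENNReal.ofReal (Real.exp (-c * t ^ 2)) = 2)
    {F : EuclideanSpace ℝ (Fin n) → ENNReal} (hF : ENNLogConcave F) (hm : Measurable F)
    (heven : ∀ x, F (-x) = F x) :
    ∫⁻ x, F x * ∏ i ∈ S, ENNReal.ofReal (Real.exp (-c * ⟪x, u i⟫ ^ 2)) ≤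
      ∫⁻ x, F x * ∏ i ∈ S, (Set.Icc (-1) 1).indicator 1 ⟪x, u i⟫ := by
  classical
  have hinner : ∀ i, Measurable fun x : EuclideanSpace ℝ (Fin n) => ⟪x, u i⟫ := by
    intro i
    fun_prop
  have hlin : ∀ {f : ℝ → ENNReal}, ENNLogConcave f → ∀ i,
      ENNLogConcave fun x : EuclideanSpace ℝ (Fin n) => f ⟪x, u i⟫ := by
    intro f hf i
    simpa [real_inner_comm] using hf.comp_linearMap (innerₛₗ ℝ (u i))
  let g : ℝ → ENNReal := fun t => ENNReal.ofReal (Real.exp (-c * t ^ 2))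
  have hg : Measurable g := by fun_prop
  let I : ℝ → ENNReal := (Set.Icc (-1) 1).indicator 1
  have hI : Measurable I := measurable_one.indicator measurableSet_Icc
  have hIneg : ∀ t, I (-t) = I t := by
    intro t
    have : -t ∈ Set.Icc (-1 : ℝ) 1 ↔ t ∈ Set.Icc (-1 : ℝ) 1 := by
      rw [Set.mem_Icc, Set.mem_Icc, ← abs_le, ← abs_le, abs_neg]
    by_cases ht : t ∈ Set.Icc (-1 : ℝ) 1 <;> simp [I, this, ht]
  induction S using Finset.induction_on generalizing F with
  | empty => simp
  | insert i S hi ih =>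
    have heven' : ∀ x, F (-x) * ∏ j ∈ S, I ⟪-x, u j⟫ = F x * ∏ j ∈ S, I ⟪x, u j⟫ := by
      intro x
      simp only [heven, inner_neg_left, hIneg]
    simp only [Finset.prod_insert hi]
    calc ∫⁻ x, F x * (g ⟪x, u i⟫ * ∏ j ∈ S, g ⟪x, u j⟫)
        = ∫⁻ x, F x * g ⟪x, u i⟫ * ∏ j ∈ S, g ⟪x, u j⟫ := by simp only [mul_assoc]
      _ ≤ ∫⁻ x, F x * g ⟪x, u i⟫ * ∏ j ∈ S, I ⟪x, u j⟫ :=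
        ih (hF.mul (hlin (.exp_neg_mul_sq hc) i)) (hm.mul (hg.comp (hinner i)))
          fun x => by simp [g, heven]
      _ = ∫⁻ x, (F x * ∏ j ∈ S, I ⟪x, u j⟫) * g ⟪x, u i⟫ := by simp only [mul_right_comm]
      _ ≤ ∫⁻ x, (F x * ∏ j ∈ S, I ⟪x, u j⟫) * I ⟪x, u i⟫ :=
        lintegral_mul_gaussian_le_lintegral_mul_slab
          (hF.mul (.prod S fun j => hlin (.indicator (convex_Icc _ _)) j))
          (hm.mul (Finset.measurable_fun_prod S fun j _ => hI.comp (hinner j)))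
          heven' hg
          (fun t => by
            simp only [g, ENNReal.ofReal_le_one, Real.exp_le_one_iff]
            nlinarith [mul_nonneg hc (sq_nonneg t)]) hc2 (hu i)
      _ = ∫⁻ x, F x * (I ⟪x, u i⟫ * ∏ j ∈ S, I ⟪x, u j⟫) := by
        refine lintegral_congr fun x => ?_
        ring

section GaussianMoments

variable {n : ℕ} {c : ℝ}

theorem integrable_exp_neg_mul_norm_sq (hc : 0 < c) :
    Integrable fun x : EuclideanSpace ℝ (Fin n) => Real.exp (-c * ‖x‖ ^ 2) := by
  refine .of_integral_ne_zero ?_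
  rw [GaussianFourier.integral_rexp_neg_mul_sq_norm hc]
  positivity

theorem integrable_norm_sq_mul_exp_neg_mul_norm_sq (hc : 0 < c) :
    Integrable fun x : EuclideanSpace ℝ (Fin n) => ‖x‖ ^ 2 * Real.exp (-c * ‖x‖ ^ 2) := by
  refine ((integrable_exp_neg_mul_norm_sq (half_pos hc)).const_mul (2 / c)).mono'
    (by fun_prop) (Filter.Eventually.of_forall fun x => ?_)
  rw [Real.norm_of_nonneg (by positivity)]
  have h1 : c / 2 * ‖x‖ ^ 2 ≤ Real.exp (c / 2 * ‖x‖ ^ 2) :=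
    (lt_add_one _).le.trans (Real.add_one_le_exp _)
  calc ‖x‖ ^ 2 * Real.exp (-c * ‖x‖ ^ 2)
      = 2 / c * (c / 2 * ‖x‖ ^ 2) * Real.exp (-c * ‖x‖ ^ 2) := by field_simp
    _ ≤ 2 / c * Real.exp (c / 2 * ‖x‖ ^ 2) * Real.exp (-c * ‖x‖ ^ 2) := by gcongr
    _ = 2 / c * Real.exp (-(c / 2) * ‖x‖ ^ 2) := by
        rw [mul_assoc, ← Real.exp_add]
        ring_nf

theorem integrable_inner_sq_mul_exp_neg_mul_norm_sq (hc : 0 < c) {u : EuclideanSpace ℝ (Fin n)}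
    (hu : ‖u‖ = 1) : Integrable fun x => ⟪x, u⟫ ^ 2 * Real.exp (-c * ‖x‖ ^ 2) := by
  refine (integrable_norm_sq_mul_exp_neg_mul_norm_sq hc).mono' (by fun_prop)
    (Filter.Eventually.of_forall fun x => ?_)
  rw [Real.norm_of_nonneg (by positivity), ← sq_abs]
  gcongr
  simpa [hu] using abs_real_inner_le_norm x u

theorem integral_inner_sq_mul_exp_neg_mul_norm_sq (hc : 0 < c) {u : EuclideanSpace ℝ (Fin n)}
    (hu : ‖u‖ = 1) :
    n * ∫ x, ⟪x, u⟫ ^ 2 * Real.exp (-c * ‖x‖ ^ 2) =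
      ∫ x : EuclideanSpace ℝ (Fin n), ‖x‖ ^ 2 * Real.exp (-c * ‖x‖ ^ 2) := by
  have key : ∀ i, ∫ x, ⟪x, u⟫ ^ 2 * Real.exp (-c * ‖x‖ ^ 2) =
      ∫ x : EuclideanSpace ℝ (Fin n), x i ^ 2 * Real.exp (-c * ‖x‖ ^ 2) := by
    intro i
    obtain ⟨b, hb⟩ := exists_orthonormalBasis_apply_eq hu i
    refine Eq.trans ?_ (b.measurePreserving_repr.integral_comp
      b.repr.toHomeomorph.measurableEmbedding fun y => y i ^ 2 * Real.exp (-c * ‖y‖ ^ 2))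
    simp only [LinearIsometryEquiv.norm_map, b.repr_apply_apply, hb, real_inner_comm]
  have hint : ∀ i, Integrable fun x : EuclideanSpace ℝ (Fin n) =>
      x i ^ 2 * Real.exp (-c * ‖x‖ ^ 2) := by
    intro i
    simpa [EuclideanSpace.inner_single_right] using
      integrable_inner_sq_mul_exp_neg_mul_norm_sq hc (u := EuclideanSpace.single i (1 : ℝ)) (by simp)
  calc n * ∫ x, ⟪x, u⟫ ^ 2 * Real.exp (-c * ‖x‖ ^ 2)
      = ∑ i : Fin n, ∫ x : EuclideanSpace ℝ (Fin n), x i ^ 2 * Real.exp (-c * ‖x‖ ^ 2) := by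
        simp only [← key, Finset.sum_const, Finset.card_univ, Fintype.card_fin, nsmul_eq_mul]
    _ = ∫ x : EuclideanSpace ℝ (Fin n), ∑ i, x i ^ 2 * Real.exp (-c * ‖x‖ ^ 2) :=
        (integral_finsetSum _ fun i _ => hint i).symm
    _ = _ := by simp only [← Finset.sum_mul, EuclideanSpace.real_norm_sq_eq]

theorem ofReal_le_lintegral_prod_gaussian {m : ℕ} (hn : 0 < n) (hm : 0 < m) (hc : 0 < c)
    {u : Fin m → EuclideanSpace ℝ (Fin n)} (hu : ∀ i, ‖u i‖ = 1) :
    ENNReal.ofReal ((Real.pi / (c * m / n)) ^ ((n : ℝ) / 2)) ≤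
      ∫⁻ x, ∏ i, ENNReal.ofReal (Real.exp (-c * ⟪x, u i⟫ ^ 2)) := by
  have hn' : (n : ℝ) ≠ 0 := by positivity
  set d := c * m / n with hd
  have hd0 : 0 < d := by positivity
  have hG := integrable_exp_neg_mul_norm_sq (n := n) hd0
  have hN := integrable_norm_sq_mul_exp_neg_mul_norm_sq (n := n) hd0
  have hI := fun i => integrable_inner_sq_mul_exp_neg_mul_norm_sq hd0 (hu i)
  have hS : Integrable fun x => ∑ i, ⟪x, u i⟫ ^ 2 * Real.exp (-d * ‖x‖ ^ 2) :=
    integrable_finsetSum _ fun i _ => hI i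
  have hmom : ∫ x, ∑ i, ⟪x, u i⟫ ^ 2 * Real.exp (-d * ‖x‖ ^ 2) =
      m / n * ∫ x : EuclideanSpace ℝ (Fin n), ‖x‖ ^ 2 * Real.exp (-d * ‖x‖ ^ 2) := by
    rw [integral_finsetSum _ fun i _ => hI i, Finset.sum_congr rfl fun i _ =>
      eq_div_of_mul_eq hn' ((mul_comm _ _).trans
        (integral_inner_sq_mul_exp_neg_mul_norm_sq hd0 (hu i)))]
    simp
    ring
  let W : EuclideanSpace ℝ (Fin n) → ℝ := fun x =>
    Real.exp (-d * ‖x‖ ^ 2) + d * (‖x‖ ^ 2 * Real.exp (-d * ‖x‖ ^ 2)) -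
      c * ∑ i, ⟪x, u i⟫ ^ 2 * Real.exp (-d * ‖x‖ ^ 2)
  have hA : Integrable fun x : EuclideanSpace ℝ (Fin n) =>
      Real.exp (-d * ‖x‖ ^ 2) + d * (‖x‖ ^ 2 * Real.exp (-d * ‖x‖ ^ 2)) := hG.add (hN.const_mul d)
  have hWint : Integrable W := hA.sub (hS.const_mul c)
  have hW : ∫ x, W x = (Real.pi / d) ^ ((n : ℝ) / 2) := by
    have hgauss := GaussianFourier.integral_rexp_neg_mul_sq_norm
      (V := EuclideanSpace ℝ (Fin n)) hd0
    rw [finrank_euclideanSpace_fin] at hgauss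
    rw [← hgauss, integral_sub hA (hS.const_mul c),
      integral_add hG (hN.const_mul d), integral_const_mul, integral_const_mul, hmom, hd]
    ring
  rw [← hW, integral_eq_lintegral_pos_part_sub_lintegral_neg_part hWint]
  refine (ENNReal.ofReal_le_ofReal (sub_le_self _ ENNReal.toReal_nonneg)).trans
    (ENNReal.ofReal_toReal_le.trans (lintegral_mono fun x => ?_))
  rw [← ENNReal.ofReal_prod_of_nonneg fun i _ => (Real.exp_pos _).le, ← Real.exp_sum]
  refine ENNReal.ofReal_le_ofReal ?_
  calc W x = (d * ‖x‖ ^ 2 - c * ∑ i, ⟪x, u i⟫ ^ 2 + 1) * Real.exp (-d * ‖x‖ ^ 2) := by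
        simp only [W, ← Finset.sum_mul]
        ring
    _ ≤ Real.exp (d * ‖x‖ ^ 2 - c * ∑ i, ⟪x, u i⟫ ^ 2) * Real.exp (-d * ‖x‖ ^ 2) := by
        gcongr
        exact Real.add_one_le_exp _
    _ = Real.exp (∑ i, -c * ⟪x, u i⟫ ^ 2) := by
        rw [← Real.exp_add, ← Finset.mul_sum]
        ring_nf

end GaussianMoments

/-- Vaaler-type bound (Lemma 8): for unit vectors `(u i)` in `ℝⁿ`, the symmetric convex
body `K = {x : |⟪x, u i⟫| ≤ 1 for all i}` satisfies `|K|^{1/n} ≥ 2 √(n/m)`. -/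
theorem stmt_15 (n m : ℕ) (u : Fin m → EuclideanSpace ℝ (Fin n))
    (hu : ∀ i, ‖u i‖ = 1)
    (K : Set (EuclideanSpace ℝ (Fin n)))
    (hK : K = {x : EuclideanSpace ℝ (Fin n) | ∀ i, |⟪x, u i⟫| ≤ 1}) :
    ENNReal.ofReal (2 * Real.sqrt ((n : ℝ) / m)) ≤ volume K ^ ((1 : ℝ) / n) := by
  rcases Nat.eq_zero_or_pos n with rfl | hn
  · simp
  rcases Nat.eq_zero_or_pos m with rfl | hm
  · simp
  have hn' : (0 : ℝ) < n := by exact_mod_cast hn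
  have hm' : (0 : ℝ) < m := by exact_mod_cast hm
  have hc : (0 : ℝ) < Real.pi / 4 := by positivity
  have hc2 : ∫⁻ t : ℝ, ENNReal.ofReal (Real.exp (-(Real.pi / 4) * t ^ 2)) = 2 := by
    rw [← ofReal_integral_eq_lintegral_ofReal (integrable_exp_neg_mul_sq hc)
      (Filter.Eventually.of_forall fun t => (Real.exp_pos _).le), integral_gaussian,
      div_div_cancel₀ Real.pi_ne_zero, show (4 : ℝ) = 2 ^ 2 by norm_num,
      Real.sqrt_sq zero_le_two]
    simp
  have hKm : MeasurableSet K := by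
    rw [hK, Set.ofPred_forall]
    exact MeasurableSet.iInter fun i => measurableSet_le (by fun_prop) measurable_const
  have hvol : ∫⁻ x, ∏ i, (Set.Icc (-1 : ℝ) 1).indicator (1 : ℝ → ENNReal) ⟪x, u i⟫ = volume K := by
    rw [← lintegral_indicator_one hKm]
    refine lintegral_congr fun x => ?_
    by_cases hx : x ∈ K
    · rw [Set.indicator_of_mem hx, Pi.one_apply]
      rw [hK] at hx
      exact Finset.prod_eq_one fun i _ => Set.indicator_of_mem (s := Set.Icc (-1 : ℝ) 1) (abs_le.1 (hx i)) _
    · rw [Set.indicator_of_notMem hx]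
      rw [hK, Set.mem_ofPred_eq, not_forall] at hx
      obtain ⟨i, hi⟩ := hx
      exact Finset.prod_eq_zero (Finset.mem_univ i)
        (Set.indicator_of_notMem (s := Set.Icc (-1 : ℝ) 1) (fun h => hi (abs_le.2 h)) _)
  have hcomp := lintegral_mul_prod_gaussian_le Finset.univ hu hc.le hc2 ENNLogConcave.one
    measurable_const fun _ => rfl
  simp only [one_mul, hvol] at hcomp
  have hbound := (ofReal_le_lintegral_prod_gaussian hn hm hc hu).trans hcomp
  refine le_trans (le_of_eq ?_) (ENNReal.rpow_le_rpow hbound (by positivity))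
  rw [ENNReal.ofReal_rpow_of_nonneg (by positivity) (by positivity),
    ← Real.rpow_mul (by positivity)]
  congr 1
  rw [show (n : ℝ) / 2 * (1 / n) = 1 / 2 by field_simp, ← Real.sqrt_eq_rpow,
    show Real.pi / (Real.pi / 4 * m / n) = 2 ^ 2 * (n / m) by
      field_simp
      norm_num,
    Real.sqrt_mul (by norm_num), Real.sqrt_sq zero_le_two]
end

section
/- (Lemma 7, from FLM/lower bound on ℓ1-norm of random vectors) There is an absolute constant δ > 0 such that for every n there exist unit vectors u_1,...,u_{2n} in R^n with Σ_{i=1}^{2n} |⟨x, u_i⟩| ≥ δ√n |x| for every x ∈ R^n. -/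
open scoped RealInnerProductSpace BigOperators
open MeasureTheory ProbabilityTheory Metric
open scoped ENNReal NNReal

lemma integral_exp_neg_abs_div {t : ℝ} (ht : 0 < t) :
    ∫ s : ℝ, Real.exp (-(|s| / t)) = 2 * t := by
  rw [integral_comp_abs (f := fun s => Real.exp (-(s / t)))]
  have h := integral_comp_mul_left_Ioi (fun s => Real.exp (-s)) 0 (inv_pos.2 ht)
  simp only [mul_zero, inv_inv, integral_exp_neg_Ioi_zero, smul_eq_mul, mul_one] at h
  simp_rw [div_eq_inv_mul, h]

lemma lintegral_exp_neg_abs_div {t : ℝ} (ht : 0 < t) :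
    ∫⁻ s : ℝ, ENNReal.ofReal (Real.exp (-(|s| / t))) = ENNReal.ofReal (2 * t) := by
  have hi := integral_exp_neg_abs_div ht
  rw [← hi, ofReal_integral_eq_lintegral_ofReal]
  · exact .of_integral_ne_zero (by rw [hi]; positivity)
  · exact .of_forall fun _ => (Real.exp_pos _).le

lemma lintegral_gaussianReal_eq {v : ℝ≥0} (hv : v ≠ 0) {f : ℝ → ℝ≥0∞} (hf : Measurable f) :
    ∫⁻ s, f s ∂gaussianReal 0 v = ∫⁻ s, gaussianPDF 0 v s * f s := by
  rw [gaussianReal_of_var_ne_zero _ hv,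
    lintegral_withDensity_eq_lintegral_mul _ (measurable_gaussianPDF 0 v) hf]
  rfl

lemma lintegral_exp_neg_abs_div_gaussianReal_le {t : ℝ} (ht : 0 < t) {v : ℝ≥0} (hv : 1 / 4 ≤ v) :
    ∫⁻ s, ENNReal.ofReal (Real.exp (-(|s| / t))) ∂gaussianReal 0 v ≤ ENNReal.ofReal (2 * t) := by
  have hv0 : v ≠ 0 := (lt_of_lt_of_le (by norm_num) hv).ne'
  have hv' : (1 / 4 : ℝ) ≤ v := by exact_mod_cast hv
  rw [lintegral_gaussianReal_eq hv0 (by fun_prop), ← lintegral_exp_neg_abs_div ht]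
  refine lintegral_mono fun s => mul_le_of_le_one_left' ?_
  rw [gaussianPDF, ENNReal.ofReal_le_one, gaussianPDFReal]
  refine mul_le_one₀ (inv_le_one_of_one_le₀ ?_) (Real.exp_pos _).le ?_
  · rw [Real.one_le_sqrt]
    nlinarith [Real.pi_gt_three]
  · rw [Real.exp_le_one_iff, neg_div, neg_nonpos]
    positivity

lemma lintegral_exp_sq_div_four_gaussianReal_le {v : ℝ≥0} (hv0 : v ≠ 0) (hv : v ≤ 1) :
    ∫⁻ s, ENNReal.ofReal (Real.exp (s ^ 2 / 4)) ∂gaussianReal 0 v ≤ ENNReal.ofReal 2 := by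
  have hv0' : (0 : ℝ) < v := by positivity
  have hv' : (v : ℝ) ≤ 1 := by exact_mod_cast hv
  set b : ℝ := 1 / (2 * v) - 1 / 4 with hb
  have hbv : 2 * v * b = 1 - v / 2 := by rw [hb]; field_simp; ring
  have hb0 : 0 < b := by
    by_contra! h
    nlinarith
  have h : ∀ s : ℝ, gaussianPDF 0 v s * ENNReal.ofReal (Real.exp (s ^ 2 / 4)) =
      ENNReal.ofReal ((√(2 * Real.pi * v))⁻¹ * Real.exp (-b * s ^ 2)) := fun s => by
    rw [gaussianPDF, ← ENNReal.ofReal_mul (gaussianPDFReal_nonneg _ _ _), gaussianPDFReal,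
      mul_assoc, ← Real.exp_add]
    congr 3
    rw [hb]
    field_simp
    ring
  rw [lintegral_gaussianReal_eq hv0 (by fun_prop), lintegral_congr h,
    ← ofReal_integral_eq_lintegral_ofReal ((integrable_exp_neg_mul_sq hb0).const_mul _)
      (.of_forall fun _ => by positivity), integral_const_mul, integral_gaussian]
  refine ENNReal.ofReal_le_ofReal ?_
  rw [inv_mul_le_iff₀ (by positivity), Real.sqrt_le_left (by positivity), mul_pow,
    Real.sq_sqrt (by positivity), div_le_iff₀ hb0]
  nlinarith [Real.pi_pos]

section StdGaussian

variable {E : Type*} [NormedAddCommGroup E] [InnerProductSpace ℝ E] [FiniteDimensional ℝ E]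
  [MeasurableSpace E] [BorelSpace E]

lemma map_inner_stdGaussian (y : E) :
    (stdGaussian E).map (fun g => ⟪y, g⟫) = gaussianReal 0 (‖y‖₊ ^ 2) := by
  have h := IsGaussian.map_eq_gaussianReal (μ := stdGaussian E) (innerSL ℝ y)
  rw [integral_strongDual_stdGaussian, variance_dual_stdGaussian, innerSL_apply_norm] at h
  rwa [Real.toNNReal_pow (norm_nonneg y), norm_toNNReal] at h

lemma lintegral_pi_stdGaussian_lintegral_prod_le {N : ℕ} {w : ℝ → ℝ≥0∞} (hw : Measurable w)
    {K : ℝ≥0∞} {R : Set E}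
    (hK : ∀ y ∈ R, ∫⁻ s, w s ∂gaussianReal 0 (‖y‖₊ ^ 2) ≤ K) :
    ∫⁻ g, (∫⁻ y in R, ∏ i, w ⟪y, g i⟫) ∂Measure.pi (fun _ : Fin N => stdGaussian E) ≤
      K ^ N * volume R := by
  have hm : Measurable fun p : (Fin N → E) × E => ∏ i, w ⟪p.2, p.1 i⟫ :=
    Finset.measurable_prod _ fun i _ => by fun_prop
  rw [lintegral_lintegral_swap hm.aemeasurable, ← setLIntegral_const]
  refine setLIntegral_mono measurable_const fun y hy => ?_
  have hind := iIndepFun_pi (ι := Fin N) (μ := fun _ => stdGaussian E)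
    (X := fun _ g => w ⟪y, g⟫) (fun _ => by fun_prop)
  rw [lintegral_prod_eq_prod_lintegral_of_indepFun _ _ hind fun i => by fun_prop]
  have hi : ∀ i : Fin N, ∫⁻ g, w ⟪y, g i⟫ ∂Measure.pi (fun _ : Fin N => stdGaussian E) ≤ K :=
    fun i => by
      rw [(measurePreserving_eval (fun _ : Fin N => stdGaussian E) i).lintegral_comp
        (f := fun g => w ⟪y, g⟫) (by fun_prop)]
      rw [← lintegral_map (f := w) hw (by fun_prop), map_inner_stdGaussian]
      exact hK y hy
  simpa using Finset.prod_le_prod' (s := Finset.univ) fun i _ => hi i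

lemma exists_le_two_mul_and_le_two_mul {Ω : Type*} [MeasurableSpace Ω] {P : Measure Ω}
    [IsProbabilityMeasure P] {f₁ f₂ : Ω → ℝ≥0∞} (h₁ : Measurable f₁) (h₂ : Measurable f₂)
    {a₁ a₂ : ℝ≥0∞} (ha₁ : a₁ ≠ 0) (ha₁' : a₁ ≠ ∞) (ha₂ : a₂ ≠ 0) (ha₂' : a₂ ≠ ∞)
    (hi₁ : ∫⁻ ω, f₁ ω ∂P ≤ a₁) (hi₂ : ∫⁻ ω, f₂ ω ∂P ≤ a₂) :
    ∃ ω, f₁ ω ≤ 2 * a₁ ∧ f₂ ω ≤ 2 * a₂ := by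
  obtain ⟨ω, hω⟩ := exists_le_lintegral (μ := P) (f := fun ω => f₁ ω / a₁ + f₂ ω / a₂)
    (by fun_prop)
  have h : ∫⁻ ω, f₁ ω / a₁ + f₂ ω / a₂ ∂P ≤ 2 := by
    rw [lintegral_add_left (by fun_prop)]
    simp_rw [div_eq_mul_inv]
    rw [lintegral_mul_const _ h₁, lintegral_mul_const _ h₂, ← one_add_one_eq_two,
      ← div_eq_mul_inv, ← div_eq_mul_inv]
    exact add_le_add (ENNReal.div_le_of_le_mul (by simpa)) (ENNReal.div_le_of_le_mul (by simpa))
  refine ⟨ω, ?_, ?_⟩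
  · exact (ENNReal.div_le_iff ha₁ ha₁').1 (le_self_add.trans (hω.trans h))
  · exact (ENNReal.div_le_iff ha₂ ha₂').1 (le_add_self.trans (hω.trans h))

lemma exists_forall_ball_subset_mul_pow_le (N : ℕ) {t : ℝ} (ht : 0 < t) :
    ∃ g : Fin N → E, ∀ (c : E) (r b : ℝ), 0 < r → 0 ≤ b →
      ball c r ⊆ closedBall 0 1 \ ball 0 (1 / 2) →
      ((∀ y ∈ ball c r, b ≤ Real.exp (-((∑ i, |⟪y, g i⟫|) / t))) →
        b * r ^ Module.finrank ℝ E ≤ 2 * (2 * t) ^ N) ∧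
      ((∀ y ∈ ball c r, b ≤ Real.exp ((∑ i, ⟪y, g i⟫ ^ 2) / 4)) →
        b * r ^ Module.finrank ℝ E ≤ 2 * 2 ^ N) := by
  set R : Set E := closedBall 0 1 \ ball 0 (1 / 2)
  have hR : MeasurableSet R := measurableSet_closedBall.diff measurableSet_ball
  set V : ℝ≥0∞ := volume (ball (0 : E) 1)
  have hV : V ≠ 0 := (measure_ball_pos volume _ one_pos).ne'
  have hV' : V ≠ ∞ := measure_ball_lt_top.ne
  have hRV : volume R ≤ V := by
    refine (measure_mono Set.sdiff_subset).trans_eq ?_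
    rw [Measure.addHaar_closedBall _ _ zero_le_one]
    simp [V]
  have hnorm : ∀ y ∈ R, 1 / 4 ≤ ‖y‖₊ ^ 2 ∧ ‖y‖₊ ^ 2 ≤ 1 := fun y hy => by
    have h1 : ‖y‖ ≤ 1 := by simpa using hy.1
    have h2 : 1 / 2 ≤ ‖y‖ := by simpa using hy.2
    constructor <;> rw [← NNReal.coe_le_coe] <;> push_cast <;> nlinarith
  set w₁ : ℝ → ℝ≥0∞ := fun s => ENNReal.ofReal (Real.exp (-(|s| / t)))
  set w₂ : ℝ → ℝ≥0∞ := fun s => ENNReal.ofReal (Real.exp (s ^ 2 / 4))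
  have hm₁ : Measurable w₁ := by fun_prop
  have hm₂ : Measurable w₂ := by fun_prop
  have hmeas : ∀ w : ℝ → ℝ≥0∞, Measurable w →
      Measurable fun g : Fin N → E => ∫⁻ y in R, ∏ i, w ⟪y, g i⟫ := fun w hw => by
    have hm : Measurable fun p : (Fin N → E) × E => ∏ i, w ⟪p.2, p.1 i⟫ :=
      Finset.measurable_prod _ fun i _ => by fun_prop
    exact hm.lintegral_prod_right'
  have key : ∀ (K : ℝ) (f : E → ℝ≥0∞), 0 ≤ K →
      ∫⁻ y in R, f y ≤ 2 * (ENNReal.ofReal K ^ N * V) →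
      ∀ (c : E) (r b : ℝ), 0 < r → 0 ≤ b → ball c r ⊆ R →
      (∀ y ∈ ball c r, ENNReal.ofReal b ≤ f y) →
      b * r ^ Module.finrank ℝ E ≤ 2 * K ^ N := by
    intro K f hK hf c r b hr hb hsub h
    have h1 : ENNReal.ofReal b * volume (ball c r) ≤ 2 * (ENNReal.ofReal K ^ N * V) := by
      rw [← setLIntegral_const]
      exact (setLIntegral_mono' measurableSet_ball h).trans ((lintegral_mono_set hsub).trans hf)
    rw [Measure.addHaar_ball_of_pos _ _ hr, ← mul_assoc, ← mul_assoc,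
      ENNReal.mul_le_mul_iff_left hV hV', ← ENNReal.ofReal_mul hb, ← ENNReal.ofReal_pow hK,
      ← ENNReal.ofReal_ofNat 2, ← ENNReal.ofReal_mul (by norm_num)] at h1
    exact (ENNReal.ofReal_le_ofReal_iff (by positivity)).1 h1
  have ha : ∀ K : ℝ, 0 < K → ENNReal.ofReal K ^ N * V ≠ 0 := fun K hK => by
    simp [hV, hK]
  have ha' : ∀ K : ℝ, ENNReal.ofReal K ^ N * V ≠ ∞ := fun K =>
    ENNReal.mul_ne_top (ENNReal.pow_ne_top ENNReal.ofReal_ne_top) hV'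
  obtain ⟨g, hg₁, hg₂⟩ := exists_le_two_mul_and_le_two_mul
    (P := Measure.pi (fun _ : Fin N => stdGaussian E)) (hmeas w₁ hm₁) (hmeas w₂ hm₂)
    (ha (2 * t) (by positivity)) (ha' _) (ha 2 two_pos) (ha' _)
    ((lintegral_pi_stdGaussian_lintegral_prod_le hm₁ fun y hy =>
      lintegral_exp_neg_abs_div_gaussianReal_le ht (hnorm y hy).1).trans (by gcongr))
    ((lintegral_pi_stdGaussian_lintegral_prod_le hm₂ fun y hy =>
      lintegral_exp_sq_div_four_gaussianReal_le
        (lt_of_lt_of_le (by norm_num) (hnorm y hy).1).ne' (hnorm y hy).2).trans (by gcongr))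
  refine ⟨g, fun c r b hr hb hsub => ⟨fun h => ?_, fun h => ?_⟩⟩
  · refine key _ _ (by positivity) hg₁ c r b hr hb hsub fun y hy => ?_
    rw [← ENNReal.ofReal_prod_of_nonneg fun _ _ => (Real.exp_pos _).le, ← Real.exp_sum]
    refine ENNReal.ofReal_le_ofReal ((h y hy).trans_eq ?_)
    rw [Finset.sum_neg_distrib, Finset.sum_div]
  · refine key _ _ (by positivity) hg₂ c r b hr hb hsub fun y hy => ?_
    rw [← ENNReal.ofReal_prod_of_nonneg fun _ _ => (Real.exp_pos _).le, ← Real.exp_sum]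
    refine ENNReal.ofReal_le_ofReal ((h y hy).trans_eq ?_)
    rw [Finset.sum_div]

end StdGaussian

section InnerProductSpace

variable {E : Type*} [NormedAddCommGroup E] [InnerProductSpace ℝ E]

lemma ball_smul_subset_annulus {x : E} (hx : ‖x‖ = 1) {r : ℝ} (hr : r ≤ 1 / 4) :
    ball ((3 / 4 : ℝ) • x) r ⊆ closedBall 0 1 \ ball 0 (1 / 2) := by
  intro y hy
  rw [mem_ball, dist_eq_norm] at hy
  have hc : ‖(3 / 4 : ℝ) • x‖ = 3 / 4 := by rw [norm_smul, hx]; norm_num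
  have h := abs_le.1 (abs_norm_sub_norm_le y ((3 / 4 : ℝ) • x))
  rw [hc] at h
  simp only [Set.mem_sdiff, mem_closedBall, mem_ball, dist_zero_right, not_lt]
  constructor <;> linarith [h.1, h.2]

lemma exists_norm_eq_one_norm_apply_eq_opNorm [FiniteDimensional ℝ E]
    [Nontrivial E] {F : Type*} [NormedAddCommGroup F]
    [NormedSpace ℝ F] (A : E →L[ℝ] F) : ∃ x : E, ‖x‖ = 1 ∧ ‖A x‖ = ‖A‖ := by
  have hne : (sphere (0 : E) 1).Nonempty := NormedSpace.sphere_nonempty.2 zero_le_one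
  obtain ⟨x, hx, hmax⟩ := (isCompact_sphere (0 : E) 1).exists_isMaxOn hne
    (f := fun x => ‖A x‖) (by fun_prop)
  have hx1 : ‖x‖ = 1 := by simpa using hx
  refine ⟨x, hx1, le_antisymm (A.unit_le_opNorm x hx1.le) ?_⟩
  exact A.opNorm_le_of_unit_norm (norm_nonneg _) fun y hy => hmax (by simpa using hy)

/-- The linear map `x ↦ (⟪x, g i⟫)ᵢ`. -/
noncomputable def analysisMap {N : ℕ} (g : Fin N → E) : E →L[ℝ] EuclideanSpace ℝ (Fin N) :=
  (EuclideanSpace.equiv (Fin N) ℝ).symm.toContinuousLinearMap.comp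
    (ContinuousLinearMap.pi fun i => innerSL ℝ (g i))

lemma norm_analysisMap_sq {N : ℕ} (g : Fin N → E) (x : E) :
    ‖analysisMap g x‖ ^ 2 = ∑ i, ⟪x, g i⟫ ^ 2 := by
  simp [EuclideanSpace.real_norm_sq_eq, analysisMap, real_inner_comm]

lemma norm_le_opNorm_analysisMap {N : ℕ} (g : Fin N → E) (i : Fin N) :
    ‖g i‖ ≤ ‖analysisMap g‖ := by
  rcases (norm_nonneg (g i)).eq_or_lt with h | h
  · rw [← h]; positivity
  refine le_of_mul_le_mul_right ?_ h
  refine le_trans ?_ ((analysisMap g).le_opNorm (g i))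
  refine le_of_sq_le_sq ?_ (norm_nonneg _)
  rw [norm_analysisMap_sq, ← real_inner_self_eq_norm_mul_norm]
  exact Finset.single_le_sum (f := fun j => ⟪g i, g j⟫ ^ 2) (fun _ _ => sq_nonneg _)
    (Finset.mem_univ i)

lemma sum_abs_inner_le {N : ℕ} (g : Fin N → E) (x : E) :
    ∑ i, |⟪x, g i⟫| ≤ √N * (‖analysisMap g‖ * ‖x‖) := by
  refine le_trans ?_ (mul_le_mul_of_nonneg_left ((analysisMap g).le_opNorm x) (Real.sqrt_nonneg _))
  refine le_of_sq_le_sq ?_ (by positivity)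
  rw [mul_pow, Real.sq_sqrt (by positivity), norm_analysisMap_sq]
  simpa using sq_sum_le_card_mul_sum_sq (s := Finset.univ) (f := fun i => |⟪x, g i⟫|)

end InnerProductSpace

lemma exists_opNorm_le_and_sum_abs_inner_ge {n : ℕ} (hn : 0 < n) {t : ℝ}
    (ht : 12 * t = Real.exp (-13)) :
    ∃ g : Fin (2 * n) → EuclideanSpace ℝ (Fin n), ‖analysisMap g‖ ≤ 8 * √n ∧
      ∀ x, ‖x‖ = 1 → n * t ≤ ∑ i, |⟪x, g i⟫| := by
  have : Nonempty (Fin n) := ⟨⟨0, hn⟩⟩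
  have ht0 : 0 < t := by linarith [Real.exp_pos (-13)]
  have ht4 : t ≤ 1 / 4 := by
    have : Real.exp (-13) ≤ 1 := Real.exp_le_one_iff.2 (by norm_num)
    linarith
  obtain ⟨g, hg⟩ :=
    exists_forall_ball_subset_mul_pow_le (E := EuclideanSpace ℝ (Fin n)) (2 * n) ht0
  rw [finrank_euclideanSpace_fin] at hg
  have hA : ‖analysisMap g‖ ≤ 8 * √n := by
    obtain ⟨x, hx, hAx⟩ := exists_norm_eq_one_norm_apply_eq_opNorm (analysisMap g)
    set a := ‖analysisMap g‖
    have h := (hg ((3 / 4 : ℝ) • x) (1 / 4) (Real.exp (a ^ 2 / 16)) (by norm_num)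
      (Real.exp_pos _).le (ball_smul_subset_annulus hx le_rfl)).2 fun y hy => by
        rw [Real.exp_le_exp, ← norm_analysisMap_sq]
        rw [mem_ball, dist_comm, dist_eq_norm] at hy
        have h1 := (analysisMap g).le_opNorm ((3 / 4 : ℝ) • x - y)
        have h2 := norm_sub_norm_le (analysisMap g ((3 / 4 : ℝ) • x)) (analysisMap g y)
        rw [← map_sub, map_smul, norm_smul, hAx, Real.norm_of_nonneg (by norm_num)] at h2
        have ha0 : 0 ≤ a := norm_nonneg _
        have h3 : a / 2 ≤ ‖analysisMap g y‖ := by nlinarith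
        nlinarith
    have h32 : (32 : ℝ) ≤ Real.exp 4 := by
      have he : Real.exp 4 = Real.exp 1 ^ 4 := by rw [← Real.exp_nat_mul]; norm_num
      rw [he]
      calc (32 : ℝ) ≤ 2.7 ^ 4 := by norm_num
        _ ≤ _ := by gcongr; linarith [Real.exp_one_gt_d9]
    have h4 : Real.exp (a ^ 2 / 16) ≤ Real.exp (n * 4) := by
      calc Real.exp (a ^ 2 / 16) = Real.exp (a ^ 2 / 16) * (1 / 4) ^ n * 4 ^ n := by
            rw [mul_assoc, ← mul_pow]; norm_num
        _ ≤ 2 * 2 ^ (2 * n) * 4 ^ n := by gcongr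
        _ = 2 * 16 ^ n := by rw [pow_mul, mul_assoc, ← mul_pow]; norm_num
        _ ≤ 2 ^ n * 16 ^ n := by gcongr; exact le_self_pow₀ (by norm_num) hn.ne'
        _ = 32 ^ n := by rw [← mul_pow]; norm_num
        _ ≤ Real.exp 4 ^ n := by gcongr
        _ = _ := by rw [← Real.exp_nat_mul]
    rw [Real.exp_le_exp] at h4
    refine le_of_sq_le_sq ?_ (by positivity)
    rw [mul_pow, Real.sq_sqrt (by positivity)]
    linarith
  refine ⟨g, hA, fun x hx => ?_⟩
  by_contra! hlt
  have h := (hg ((3 / 4 : ℝ) • x) t (Real.exp (-13) ^ n) ht0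
    (by positivity) (ball_smul_subset_annulus hx ht4)).1 fun y hy => by
      rw [mem_ball, dist_eq_norm] at hy
      rw [← Real.exp_nat_mul, Real.exp_le_exp, mul_neg, neg_le_neg_iff, div_le_iff₀ ht0]
      have h1 : √((2 * n : ℕ) : ℝ) * (8 * √n) ≤ 12 * n := by
        push_cast
        rw [Real.sqrt_mul (by norm_num)]
        have h2 : √(2 : ℝ) ≤ 3 / 2 := by rw [Real.sqrt_le_left (by norm_num)]; norm_num
        have h3 : √(n : ℝ) * √n = n := Real.mul_self_sqrt (by positivity)
        nlinarith [Real.sqrt_nonneg (n : ℝ)]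
      have h2 : ∑ i, |⟪y - (3 / 4 : ℝ) • x, g i⟫| ≤ 12 * n * t := by
        refine (sum_abs_inner_le g _).trans ?_
        rw [← mul_assoc]
        exact mul_le_mul ((mul_le_mul_of_nonneg_left hA (Real.sqrt_nonneg _)).trans h1) hy.le
          (norm_nonneg _) (by positivity)
      calc ∑ i, |⟪y, g i⟫| ≤ ∑ i, (|⟪x, g i⟫| + |⟪y - (3 / 4 : ℝ) • x, g i⟫|) := by
            refine Finset.sum_le_sum fun i _ => ?_
            rw [inner_sub_left, real_inner_smul_left]
            have h4 : |3 / 4 * ⟪x, g i⟫| ≤ |⟪x, g i⟫| := by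
              rw [abs_mul, abs_of_pos (by norm_num : (0 : ℝ) < 3 / 4)]
              linarith [abs_nonneg ⟪x, g i⟫]
            have h5 := abs_add_le (3 / 4 * ⟪x, g i⟫) (⟪y, g i⟫ - 3 / 4 * ⟪x, g i⟫)
            rw [add_sub_cancel] at h5
            linarith
        _ ≤ n * t + 12 * n * t := by rw [Finset.sum_add_distrib]; gcongr
        _ = n * 13 * t := by ring
  have h3 : (3 : ℝ) ^ n * (4 * t ^ 2) ^ n ≤ 2 * (4 * t ^ 2) ^ n := by
    calc (3 : ℝ) ^ n * (4 * t ^ 2) ^ n = Real.exp (-13) ^ n * t ^ n := by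
          rw [← ht, ← mul_pow, ← mul_pow]; ring
      _ ≤ 2 * (2 * t) ^ (2 * n) := h
      _ = _ := by rw [pow_mul]; ring
  have h4 : (3 : ℝ) ^ n ≤ 2 := le_of_mul_le_mul_right h3 (by positivity)
  have h5 : (3 : ℝ) ≤ 3 ^ n := le_self_pow₀ (by norm_num) hn.ne'
  linarith

/-- Lemma 7: there is an absolute constant `δ > 0` such that for every `n` there exist
`2n` unit vectors `u i` in `ℝⁿ` with `∑ i, |⟪x, u i⟫| ≥ δ √n ‖x‖` for every `x`. -/
theorem stmt_17 :
    ∃ δ : ℝ, 0 < δ ∧ ∀ n : ℕ,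
      ∃ u : Fin (2 * n) → EuclideanSpace ℝ (Fin n),
        (∀ i, ‖u i‖ = 1) ∧
        ∀ x : EuclideanSpace ℝ (Fin n),
          δ * Real.sqrt n * ‖x‖ ≤ ∑ i, |⟪x, u i⟫| := by
  obtain ⟨t, ht⟩ : ∃ t : ℝ, 12 * t = Real.exp (-13) := ⟨Real.exp (-13) / 12, by ring⟩
  have ht0 : 0 < t := by linarith [Real.exp_pos (-13)]
  refine ⟨t / 8, by positivity, fun n => ?_⟩
  rcases Nat.eq_zero_or_pos n with rfl | hn
  · exact ⟨fun _ => 0, fun i => i.elim0, fun x => by simp⟩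
  have : Nonempty (Fin n) := ⟨⟨0, hn⟩⟩
  obtain ⟨g, hA, hg⟩ := exists_opNorm_le_and_sum_abs_inner_ge hn ht
  obtain ⟨e, he⟩ := exists_norm_eq (EuclideanSpace ℝ (Fin n)) zero_le_one
  have hu : ∀ i, ∃ v : EuclideanSpace ℝ (Fin n), ‖v‖ = 1 ∧ g i = ‖g i‖ • v := fun i => by
    by_cases h : g i = 0
    · exact ⟨e, he, by simp [h]⟩
    · have h' : ‖g i‖ ≠ 0 := norm_ne_zero_iff.2 h
      exact ⟨‖g i‖⁻¹ • g i, norm_smul_inv_norm h, by rw [smul_inv_smul₀ h']⟩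
  choose u hu1 hgu using hu
  have hs : 0 < √(n : ℝ) := by positivity
  refine ⟨u, hu1, fun x => ?_⟩
  have hx : n * t * ‖x‖ ≤ ∑ i, |⟪x, g i⟫| := by
    by_cases h : x = 0
    · simp [h]
    have h' : 0 < ‖x‖ := norm_pos_iff.2 h
    have h1 := hg (‖x‖⁻¹ • x) (norm_smul_inv_norm h)
    simp_rw [real_inner_smul_left, abs_mul, abs_of_pos (inv_pos.2 h'), ← Finset.mul_sum] at h1
    rwa [le_inv_mul_iff₀ h', mul_comm] at h1
  have hle : ∑ i, |⟪x, g i⟫| ≤ 8 * √n * ∑ i, |⟪x, u i⟫| := by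
    rw [Finset.mul_sum]
    refine Finset.sum_le_sum fun i _ => ?_
    rw [hgu i, real_inner_smul_right, abs_mul, abs_norm]
    gcongr
    exact (norm_le_opNorm_analysisMap g i).trans hA
  have h3 : √(n : ℝ) * √n = n := Real.mul_self_sqrt (by positivity)
  refine le_of_mul_le_mul_left ?_ (by positivity : 0 < 8 * √(n : ℝ))
  calc 8 * √(n : ℝ) * (t / 8 * √n * ‖x‖) = √(n : ℝ) * √n * t * ‖x‖ := by ring
    _ ≤ _ := by rw [h3]; exact hx.trans hle
end

section
/- (Cauchy's formula) For a convex body C in R^n, the surface area of C equals (n v_n / v_{n−1}) ∫_{S^{n−1}} |P_θ C| dσ(θ), where v_k is the volume of the k-dimensional Euclidean unit ball and σ is the rotation-invariant probability measure on S^{n−1}. -/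
open MeasureTheory
open scoped RealInnerProductSpace

open Module Submodule

theorem hausdorffMeasure_vadd_set {E : Type*} [NormedAddCommGroup E] [MeasurableSpace E]
    [BorelSpace E] {d : ℝ} (c : E) (s : Set E) : μH[d] ((fun x ↦ c + x) '' s) = μH[d] s :=
  (IsometryEquiv.addLeft c).hausdorffMeasure_image d s

section Projection

variable {E : Type*} [NormedAddCommGroup E] [InnerProductSpace ℝ E]

/-- For `‖θ‖ = 1`, this is the orthogonal projection onto `θ^⊥`. -/
noncomputable def removeComponent (θ : E) : E →ₗ[ℝ] E where
  toFun x := x - ⟪θ, x⟫ • θ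
  map_add' x y := by simp only [inner_add_right, add_smul]; abel
  map_smul' c x := by simp [inner_smul_right, smul_sub, mul_smul]

theorem removeComponent_apply (θ x : E) : removeComponent θ x = x - ⟪θ, x⟫ • θ := rfl

theorem removeComponent_neg (θ : E) : removeComponent (-θ) = removeComponent θ := by
  ext x; simp [removeComponent_apply]

theorem inner_removeComponent {θ : E} (hθ : ‖θ‖ = 1) (x y : E) :
    ⟪removeComponent θ x, removeComponent θ y⟫ = ⟪x, y⟫ - ⟪θ, x⟫ * ⟪θ, y⟫ := by
  simp only [removeComponent_apply, inner_sub_left, inner_sub_right, inner_smul_left,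
    inner_smul_right, real_inner_self_eq_norm_sq, hθ, real_inner_comm x θ]
  simp

theorem norm_removeComponent_le {θ : E} (hθ : ‖θ‖ = 1) (x : E) : ‖removeComponent θ x‖ ≤ ‖x‖ := by
  refine le_of_sq_le_sq ?_ (norm_nonneg x)
  rw [← real_inner_self_eq_norm_sq, inner_removeComponent hθ, real_inner_self_eq_norm_sq]
  nlinarith [mul_self_nonneg ⟪θ, x⟫]

theorem lipschitzWith_removeComponent {θ : E} (hθ : ‖θ‖ = 1) :
    LipschitzWith 1 (removeComponent θ) := by
  refine LipschitzWith.of_dist_le_mul fun x y ↦ ?_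
  rw [dist_eq_norm, dist_eq_norm, ← map_sub]
  simpa using norm_removeComponent_le hθ (x - y)

theorem removeComponent_add_smul {θ : E} (hθ : ‖θ‖ = 1) (x : E) (t : ℝ) :
    removeComponent θ (x + t • θ) = removeComponent θ x := by
  simp [removeComponent_apply, inner_add_right, inner_smul_right, hθ, add_smul]

theorem exists_eq_add_smul_of_removeComponent_eq {θ x y : E}
    (h : removeComponent θ x = removeComponent θ y) : ∃ t : ℝ, y = x + t • θ := by
  refine ⟨⟪θ, y⟫ - ⟪θ, x⟫, ?_⟩
  simp only [removeComponent_apply] at h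
  rw [sub_smul, add_sub_left_comm, h]
  abel

theorem normDet_removeComponent_domRestrict [FiniteDimensional ℝ E] {θ u : E} (hθ : ‖θ‖ = 1)
    (hu : ‖u‖ = 1) : ((removeComponent θ).domRestrict (ℝ ∙ u)ᗮ).normDet = |⟪u, θ⟫| := by
  set U := (ℝ ∙ u)ᗮ
  set b := stdOrthonormalBasis ℝ U
  rw [← abs_of_nonneg (LinearMap.normDet_nonneg _), ← sq_eq_sq_iff_abs_eq_abs]
  have h := ((removeComponent θ).domRestrict U).normDet_sq_eq_det_gram b
  simp only [RCLike.ofReal_real_eq_id, id] at h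
  rw [h]
  have hgram : Matrix.gram ℝ (fun i ↦ (removeComponent θ).domRestrict U (b i)) =
      1 + Matrix.replicateCol Unit (fun i ↦ ⟪θ, (b i : E)⟫) *
        Matrix.replicateRow Unit (fun i ↦ -⟪θ, (b i : E)⟫) := by
    ext i j
    have hb : ⟪(b i : E), (b j : E)⟫ = if i = j then 1 else 0 :=
      (orthonormal_iff_ite.mp b.orthonormal) i j
    simp [Matrix.gram_apply, inner_removeComponent hθ, hb, Matrix.mul_apply, Matrix.one_apply,
      sub_eq_add_neg]
  rw [hgram, Matrix.det_one_add_replicateCol_mul_replicateRow]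
  have hsum : ∑ i, ⟪θ, (b i : E)⟫ ^ 2 = ‖U.orthogonalProjectionOnto θ‖ ^ 2 := by
    rw [← b.sum_sq_norm_inner_right]
    refine Finset.sum_congr rfl fun i _ ↦ ?_
    rw [Real.norm_eq_abs, sq_abs, real_inner_comm, ← inner_orthogonalProjectionOnto_eq_of_mem_left]
  have hpyth := (ℝ ∙ u).norm_sq_eq_add_norm_sq_projection θ
  have hproj : ‖(ℝ ∙ u).orthogonalProjectionOnto θ‖ ^ 2 = ⟪u, θ⟫ ^ 2 := by
    rw [coe_norm, coe_orthogonalProjectionOnto_apply,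
      starProjection_unit_singleton ℝ hu, norm_smul, hu]
    simp
  have hdot : (fun i ↦ -⟪θ, (b i : E)⟫) ⬝ᵥ (fun i ↦ ⟪θ, (b i : E)⟫) =
      -∑ i, ⟪θ, (b i : E)⟫ ^ 2 := by
    simp [dotProduct, ← Finset.sum_neg_distrib, sq]
  rw [hdot, hsum]
  rw [hθ, hproj] at hpyth
  linarith

theorem finrank_orthogonal_span_singleton_eq {m : ℕ} (hm : finrank ℝ E = m + 1) {u : E}
    (hu : ‖u‖ = 1) : finrank ℝ (ℝ ∙ u)ᗮ = m := by
  have : Fact (finrank ℝ E = m + 1) := ⟨hm⟩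
  exact finrank_orthogonal_span_singleton (by rintro rfl; simp at hu)

theorem exists_eq_image_of_subset_hyperplane {u : E} {b : ℝ} (hu : ‖u‖ = 1) {s : Set E}
    (hs : ∀ x ∈ s, ⟪u, x⟫ = b) :
    ∃ A : Set (ℝ ∙ u)ᗮ, s = (fun x ↦ b • u + x) '' (Subtype.val '' A) := by
  refine ⟨{a | b • u + (a : E) ∈ s}, ?_⟩
  ext x
  simp only [Set.mem_image, Set.mem_ofPred_eq, Subtype.exists, exists_and_left, exists_prop]
  constructor
  · intro hx
    refine ⟨x - b • u, ⟨_, by simpa using hx, ⟨?_, rfl⟩⟩, by simp⟩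
    rw [mem_orthogonal_singleton_iff_inner_right]
    simp [inner_sub_right, inner_smul_right, hs x hx, hu]
  · rintro ⟨_, ⟨y, hy, -, rfl⟩, rfl⟩
    exact hy

variable [FiniteDimensional ℝ E] [MeasurableSpace E] [BorelSpace E] {m : ℕ}

/-- The orthogonal projection onto `θ^⊥` scales the area of subsets of a hyperplane by the cosine
of the angle between the normals. -/
theorem hausdorffMeasure_removeComponent_image (hm : finrank ℝ E = m + 1) {θ u : E} (hθ : ‖θ‖ = 1)
    (hu : ‖u‖ = 1) {b : ℝ} {s : Set E} (hs : ∀ x ∈ s, ⟪u, x⟫ = b) :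
    μH[(m : ℝ)] (removeComponent θ '' s) = ENNReal.ofReal |⟪u, θ⟫| * μH[(m : ℝ)] s := by
  obtain ⟨A, rfl⟩ := exists_eq_image_of_subset_hyperplane hu hs
  have h := ((removeComponent θ).domRestrict (ℝ ∙ u)ᗮ).hausdorffMeasure_image A
  rw [normDet_removeComponent_domRestrict hθ hu, finrank_orthogonal_span_singleton_eq hm hu] at h
  have hA : μH[(m : ℝ)] (Subtype.val '' A) = μH[(m : ℝ)] A :=
    isometry_subtype_coe.hausdorffMeasure_image (Or.inl m.cast_nonneg) A
  rw [hausdorffMeasure_vadd_set, hA, ← h,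
    ← hausdorffMeasure_vadd_set (removeComponent θ (b • u)) (_ '' A)]
  simp [Set.image_image]

theorem hausdorffMeasure_lt_top_of_subset_hyperplane (hm : finrank ℝ E = m + 1) {u : E}
    (hu : ‖u‖ = 1) {b : ℝ} {s : Set E} (hs : ∀ x ∈ s, ⟪u, x⟫ = b) (hsb : Bornology.IsBounded s) :
    μH[(m : ℝ)] s < ⊤ := by
  obtain ⟨A, rfl⟩ := exists_eq_image_of_subset_hyperplane hu hs
  rw [hausdorffMeasure_vadd_set,
    isometry_subtype_coe.hausdorffMeasure_image (Or.inl m.cast_nonneg)]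
  have hA : Bornology.IsBounded A := by
    have hi : Isometry (fun a : (ℝ ∙ u)ᗮ ↦ b • u + (a : E)) :=
      (IsometryEquiv.addLeft (b • u)).isometry.comp isometry_subtype_coe
    rw [Set.image_image] at hsb
    exact (hi.antilipschitz.isBounded_preimage hsb).subset (Set.subset_preimage_image _ _)
  have := hA.measure_lt_top (μ := μH[finrank ℝ (ℝ ∙ u)ᗮ])
  rwa [finrank_orthogonal_span_singleton_eq hm hu] at this

theorem hausdorffMeasure_inter_hyperplanes_eq_zero (hm : finrank ℝ E = m + 1) {u v : E}
    (hu : ‖u‖ = 1) (hv : v ∉ ℝ ∙ u) {b c : ℝ} {s : Set E} (hs : ∀ x ∈ s, ⟪u, x⟫ = b)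
    (hs' : ∀ x ∈ s, ⟪v, x⟫ = c) : μH[(m : ℝ)] s = 0 := by
  rcases s.eq_empty_or_nonempty with rfl | ⟨p, hp⟩
  · simp
  set W := (ℝ ∙ u)ᗮ ⊓ (ℝ ∙ v)ᗮ
  have hlt : W < (ℝ ∙ u)ᗮ := by
    refine lt_of_le_of_ne inf_le_left fun h ↦ hv ?_
    have h1 : (ℝ ∙ u)ᗮ ≤ (ℝ ∙ v)ᗮ := inf_eq_left.mp h
    exact (orthogonal_le_orthogonal_iff.mp h1) (mem_span_singleton_self v)
  have hfin : (finrank ℝ W : ℝ) < m := by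
    have := finrank_lt_finrank_of_lt hlt
    rw [finrank_orthogonal_span_singleton_eq hm hu] at this
    exact_mod_cast this
  have hsub : s ⊆ (fun x ↦ p + x) '' (Subtype.val '' (Set.univ : Set W)) := by
    intro x hx
    refine ⟨x - p, ⟨⟨x - p, ?_⟩, trivial, rfl⟩, by simp⟩
    refine mem_inf.mpr ⟨?_, ?_⟩ <;> rw [mem_orthogonal_singleton_iff_inner_right] <;>
      simp [inner_sub_right, hs x hx, hs p hp, hs' x hx, hs' p hp]
  refine measure_mono_null hsub ?_
  rw [hausdorffMeasure_vadd_set,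
    isometry_subtype_coe.hausdorffMeasure_image (Or.inl m.cast_nonneg),
    Real.hausdorffMeasure_of_finrank_lt hfin]
  simp

end Projection

section Frontier

theorem IsPreconnected.inter_frontier_nonempty {X : Type*} [TopologicalSpace X] {s t : Set X}
    (ht : IsPreconnected t) (h : (t ∩ s).Nonempty) (h' : (t ∩ sᶜ).Nonempty) :
    (t ∩ frontier s).Nonempty := by
  by_contra hne
  have hfr : ∀ x ∈ t, x ∉ frontier s := fun x hx hxf ↦ hne ⟨x, hx, hxf⟩
  have hin : ∀ x ∈ t, x ∈ s → x ∈ interior s := fun x hx hxs ↦ by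
    by_contra hxi
    exact hfr x hx ⟨subset_closure hxs, hxi⟩
  have hout : ∀ x ∈ t, x ∉ s → x ∈ (closure s)ᶜ := fun x hx hxs hxc ↦
    hfr x hx ⟨hxc, fun hxi ↦ hxs (interior_subset hxi)⟩
  obtain ⟨x, hx, hxs⟩ := h
  obtain ⟨y, hy, hys⟩ := h'
  obtain ⟨z, -, hz, hz'⟩ := ht (interior s) (closure s)ᶜ isOpen_interior
    isClosed_closure.isOpen_compl (fun w hw ↦ (em (w ∈ s)).imp (hin w hw) (hout w hw))
    ⟨x, hx, hin x hx hxs⟩ ⟨y, hy, hout y hy hys⟩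
  exact hz' (subset_closure (interior_subset hz))

variable {E : Type*} [NormedAddCommGroup E] [NormedSpace ℝ E]

theorem exists_pos_add_smul_mem_of_mem_interior {s : Set E} {x : E} (hx : x ∈ interior s) (v : E) :
    ∃ t : ℝ, 0 < t ∧ x + t • v ∈ s := by
  have hc : Filter.Tendsto (fun t : ℝ ↦ x + t • v) (nhdsWithin 0 (Set.Ioi 0)) (nhds x) := by
    have : Continuous fun t : ℝ ↦ x + t • v := by fun_prop
    simpa using (this.tendsto 0).mono_left nhdsWithin_le_nhds
  have h := hc.eventually (mem_interior_iff_mem_nhds.mp hx)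
  obtain ⟨t, ht, ht'⟩ := (h.and self_mem_nhdsWithin).exists
  exact ⟨t, ht', ht⟩

theorem exists_nonneg_add_smul_notMem_of_isBounded {s : Set E} (hs : Bornology.IsBounded s) (x : E)
    {v : E} (hv : v ≠ 0) : ∃ t : ℝ, 0 ≤ t ∧ x + t • v ∉ s := by
  obtain ⟨R, hR⟩ := hs.exists_norm_le
  have hv' : 0 < ‖v‖ := norm_pos_iff.mpr hv
  refine ⟨(|R| + ‖x‖ + 1) / ‖v‖, by positivity, fun hmem ↦ ?_⟩
  have h1 := hR _ hmem
  have h2 := norm_sub_norm_le ((((|R| + ‖x‖ + 1) / ‖v‖) • v)) (-x)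
  rw [norm_smul, Real.norm_of_nonneg (by positivity), div_mul_cancel₀ _ hv'.ne', norm_neg,
    sub_neg_eq_add, add_comm _ x] at h2
  linarith [le_abs_self R]

theorem exists_nonneg_add_smul_mem_frontier {s : Set E} (hs : Bornology.IsBounded s) {x : E}
    (hx : x ∈ s) {v : E} (hv : v ≠ 0) : ∃ t : ℝ, 0 ≤ t ∧ x + t • v ∈ frontier s := by
  obtain ⟨t, ht, hts⟩ := exists_nonneg_add_smul_notMem_of_isBounded hs x hv
  have hpre : IsPreconnected ((fun t : ℝ ↦ x + t • v) '' Set.Ici 0) :=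
    isPreconnected_Ici.image _ (by fun_prop)
  obtain ⟨_, ⟨r, hr, rfl⟩, hrf⟩ := hpre.inter_frontier_nonempty
    ⟨x, ⟨0, Set.self_mem_Ici, by simp⟩, hx⟩ ⟨_, ⟨t, ht, rfl⟩, hts⟩
  exact ⟨r, hr, hrf⟩

end Frontier

section InnerFrontier

variable {E : Type*} [NormedAddCommGroup E] [InnerProductSpace ℝ E]

theorem exists_supporting_vector [CompleteSpace E] {K : Set E} (hK : Convex ℝ K)
    (hKi : (interior K).Nonempty) {x : E} (hx : x ∈ frontier K) :
    ∃ v : E, v ≠ 0 ∧ ∀ y ∈ K, ⟪v, y - x⟫ ≤ 0 := by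
  obtain ⟨f, hf⟩ := geometric_hahn_banach_open_point hK.interior isOpen_interior hx.2
  set v := (InnerProductSpace.toDual ℝ E).symm f
  have hv : ∀ y, ⟪v, y⟫ = f y := fun y ↦ InnerProductSpace.toDual_symm_apply
  obtain ⟨z, hz⟩ := hKi
  refine ⟨v, fun h0 ↦ ?_, fun y hy ↦ ?_⟩
  · have := hf z hz
    rw [← hv, ← hv, h0] at this
    simp at this
  · have hcl : K ⊆ closure (interior K) := by
      rw [hK.closure_interior_eq_closure_of_nonempty_interior ⟨z, hz⟩]
      exact subset_closure
    have hle : closure (interior K) ⊆ {y | f y ≤ f x} :=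
      closure_minimal (fun a ha ↦ (hf a ha).le) (isClosed_le f.continuous continuous_const)
    have := hle (hcl hy)
    rw [inner_sub_right, hv, hv]
    exact sub_nonpos.mpr this

/-- The surface area of convex bodies is monotone under inclusion. -/
theorem hausdorffMeasure_frontier_mono [CompleteSpace E] [MeasurableSpace E] [BorelSpace E]
    {K L : Set E} (hK : Convex ℝ K) (hKc : IsClosed K) (hKi : (interior K).Nonempty) (hKL : K ⊆ L)
    (hL : Bornology.IsBounded L) {d : ℝ} (hd : 0 ≤ d) :
    μH[d] (frontier K) ≤ μH[d] (frontier L) := by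
  have hex : ∀ x : frontier K, ∃ p ∈ frontier L, ∀ y ∈ K, ⟪p - x, y - x⟫ ≤ 0 := by
    rintro ⟨x, hx⟩
    obtain ⟨v, hv, hvK⟩ := exists_supporting_vector hK hKi hx
    obtain ⟨t, ht, htL⟩ :=
      exists_nonneg_add_smul_mem_frontier hL (hKL (hKc.frontier_subset hx)) hv
    refine ⟨_, htL, fun y hy ↦ ?_⟩
    rw [add_sub_cancel_left, real_inner_smul_left]
    exact mul_nonpos_of_nonneg_of_nonpos ht (hvK y hy)
  choose p hpL hp using hex
  have hanti : AntilipschitzWith 1 p := by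
    refine AntilipschitzWith.of_le_mul_dist fun x y ↦ ?_
    have h1 := hp x y (hKc.frontier_subset y.2)
    have h2 := hp y x (hKc.frontier_subset x.2)
    have h3 : ‖(x : E) - y‖ ^ 2 ≤ ⟪p x - p y, (x : E) - y⟫ := by
      rw [← real_inner_self_eq_norm_sq]
      have : ⟪p x - p y, (x : E) - y⟫ - ⟪(x : E) - y, (x : E) - y⟫ =
          -⟪p x - x, (y : E) - x⟫ - ⟪p y - y, (x : E) - y⟫ := by
        simp only [inner_sub_left, inner_sub_right]
        ring
      linarith
    have h4 := real_inner_le_norm (p x - p y) ((x : E) - y)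
    rw [Subtype.dist_eq, dist_eq_norm, dist_eq_norm, NNReal.coe_one, one_mul]
    rcases (norm_nonneg ((x : E) - y)).eq_or_lt with h0 | h0
    · rw [← h0]; positivity
    · nlinarith
  have h := hanti.le_hausdorffMeasure_image hd Set.univ
  rw [← isometry_subtype_coe.hausdorffMeasure_image (Or.inl hd), Set.image_univ,
    Subtype.range_coe] at h
  simp only [ENNReal.coe_one, ENNReal.one_rpow, one_mul] at h
  exact h.trans (measure_mono (by rintro _ ⟨x, -, rfl⟩; exact hpL x))

end InnerFrontier

section Polytope

open scoped Pointwise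

variable {E : Type*} [NormedAddCommGroup E] [InnerProductSpace ℝ E]

/-- The intersection of the half-spaces `{x | ⟪u, x⟫ ≤ b}` for `(u, b) ∈ I`. -/
def polytope (I : Finset (E × ℝ)) : Set E := {x | ∀ p ∈ I, ⟪p.1, x⟫ ≤ p.2}

/-- The face of `polytope I` lying in the hyperplane `{x | ⟪p.1, x⟫ = p.2}`. -/
def polytopeFace (I : Finset (E × ℝ)) (p : E × ℝ) : Set E := {x ∈ polytope I | ⟪p.1, x⟫ = p.2}

theorem isClosed_polytope (I : Finset (E × ℝ)) : IsClosed (polytope I) := by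
  have : polytope I = ⋂ p ∈ I, {x | ⟪p.1, x⟫ ≤ p.2} := by ext; simp [polytope]
  rw [this]
  exact isClosed_biInter fun p _ ↦ isClosed_le (by fun_prop) continuous_const

theorem convex_polytope (I : Finset (E × ℝ)) : Convex ℝ (polytope I) := by
  have : polytope I = ⋂ p ∈ I, {x | innerSL ℝ p.1 x ≤ p.2} := by ext; simp [polytope]
  rw [this]
  exact convex_iInter₂ fun p _ ↦ convex_halfSpace_le (innerSL ℝ p.1).isLinear _

theorem isClosed_polytopeFace (I : Finset (E × ℝ)) (p : E × ℝ) : IsClosed (polytopeFace I p) :=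
  (isClosed_polytope I).inter (isClosed_eq (by fun_prop) continuous_const)

theorem frontier_polytope {I : Finset (E × ℝ)} (hI : ∀ p ∈ I, ‖p.1‖ = 1) :
    frontier (polytope I) = ⋃ p ∈ I, polytopeFace I p := by
  rw [(isClosed_polytope I).frontier_eq]
  ext x
  simp only [Set.mem_sdiff, Set.mem_iUnion, exists_prop]
  constructor
  · rintro ⟨hx, hxi⟩
    by_contra! hne
    refine hxi (mem_interior.mpr ⟨⋂ p ∈ I, {x | ⟪p.1, x⟫ < p.2}, ?_, ?_, ?_⟩)
    · exact fun y hy p hp ↦ (Set.mem_iInter₂.mp hy p hp).le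
    · exact isOpen_biInter_finset fun p _ ↦ isOpen_lt (by fun_prop) continuous_const
    · exact Set.mem_iInter₂.mpr fun p hp ↦ lt_of_le_of_ne (hx p hp) fun h ↦ hne p hp ⟨hx, h⟩
  · rintro ⟨p, hp, hx, hxp⟩
    refine ⟨hx, fun hxi ↦ ?_⟩
    obtain ⟨t, ht, htL⟩ := exists_pos_add_smul_mem_of_mem_interior hxi p.1
    have := htL p hp
    rw [inner_add_right, inner_smul_right, real_inner_self_eq_norm_sq, hI p hp, hxp] at this
    linarith

theorem exists_polytope_between [FiniteDimensional ℝ E] {C : Set E} (hC : Convex ℝ C)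
    (hCc : IsCompact C) (h0 : 0 ∈ interior C) {r : ℝ} (hr : 1 < r) :
    ∃ I : Finset (E × ℝ), (∀ p ∈ I, ‖p.1‖ = 1) ∧ C ⊆ polytope I ∧ polytope I ⊆ r • C := by
  classical
  have h0C : (0 : E) ∈ C := interior_subset h0
  have hsub : C ⊆ interior (r • C) := by
    have h := hC.closure_subset_interior_image_homothety_of_one_lt h0 r hr
    have h2 : AffineMap.homothety (0 : E) r '' C = r • C := by
      ext; simp [AffineMap.homothety_apply, Set.mem_smul_set]
    rw [h2] at h
    exact subset_closure.trans h
  have hrc : IsCompact (r • C) := hCc.smul r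
  have hsep : ∀ y ∈ frontier (r • C), ∃ p : E × ℝ, ‖p.1‖ = 1 ∧ (∀ a ∈ C, ⟪p.1, a⟫ ≤ p.2) ∧
      p.2 < ⟪p.1, y⟫ := by
    intro y hy
    obtain ⟨f, b, hfC, hfy⟩ := geometric_hahn_banach_closed_point hC hCc.isClosed
      (fun hyC ↦ hy.2 (hsub hyC))
    set v := (InnerProductSpace.toDual ℝ E).symm f
    have hv : ∀ y, ⟪v, y⟫ = f y := fun y ↦ InnerProductSpace.toDual_symm_apply
    have hv0 : 0 < ‖v‖ := by
      refine norm_pos_iff.mpr fun h ↦ ?_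
      have h1 := (hfC 0 h0C).trans hfy
      rw [← hv, ← hv, h] at h1
      simp at h1
    refine ⟨(‖v‖⁻¹ • v, ‖v‖⁻¹ * b), norm_smul_inv_norm (norm_pos_iff.mp hv0), fun a ha ↦ ?_, ?_⟩
    · rw [real_inner_smul_left, hv]
      exact mul_le_mul_of_nonneg_left (hfC a ha).le (by positivity)
    · rw [real_inner_smul_left, hv]
      exact mul_lt_mul_of_pos_left hfy (by positivity)
  choose! p hp1 hpC hpy using hsep
  have hfc : IsCompact (frontier (r • C)) := hrc.of_isClosed_subset isClosed_frontier
    hrc.isClosed.frontier_subset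
  obtain ⟨t, htf, ht⟩ := hfc.elim_nhds_subcover (fun y ↦ {x | (p y).2 < ⟪(p y).1, x⟫})
    fun y hy ↦ (isOpen_lt continuous_const (by fun_prop)).mem_nhds (hpy y hy)
  refine ⟨t.image p, ?_, fun a ha ↦ ?_, fun x hx ↦ ?_⟩
  · simp only [Finset.mem_image]
    rintro _ ⟨y, hy, rfl⟩
    exact hp1 y (htf y hy)
  · simp only [polytope, Finset.mem_image]
    rintro _ ⟨y, hy, rfl⟩
    exact hpC y (htf y hy) a ha
  · by_contra hxC
    have hL0 : (0 : E) ∈ polytope (t.image p) := by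
      simp only [polytope, Finset.mem_image]
      rintro _ ⟨y, hy, rfl⟩
      exact hpC y (htf y hy) 0 h0C
    have hseg := (convex_segment (𝕜 := ℝ) (0 : E) x).isPreconnected
    obtain ⟨z, hz, hzf⟩ := hseg.inter_frontier_nonempty
      ⟨0, left_mem_segment ℝ _ _, interior_subset (hsub h0C)⟩ ⟨x, right_mem_segment ℝ _ _, hxC⟩
    have hzL := (convex_polytope _).segment_subset hL0 hx hz
    obtain ⟨y, hy, hzy⟩ := Set.mem_iUnion₂.mp (ht hzf)
    exact absurd (hzL (p y) (Finset.mem_image_of_mem p hy)) (not_le.mpr hzy)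

theorem removeComponent_image_polytope {I : Finset (E × ℝ)}
    (hb : Bornology.IsBounded (polytope I)) {θ : E} (hθ : ‖θ‖ = 1) :
    removeComponent θ '' polytope I =
      ⋃ p ∈ I.filter (fun p ↦ 0 < ⟪p.1, θ⟫), removeComponent θ '' polytopeFace I p := by
  refine Set.Subset.antisymm ?_ (Set.iUnion₂_subset fun p _ ↦ Set.image_mono fun x hx ↦ hx.1)
  rintro _ ⟨x, hx, rfl⟩
  set J := I.filter fun p ↦ 0 < ⟪p.1, θ⟫
  have hJ : J.Nonempty := by
    by_contra hJ
    rw [Finset.not_nonempty_iff_eq_empty, Finset.filter_eq_empty_iff] at hJ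
    obtain ⟨t, ht, htL⟩ := exists_nonneg_add_smul_notMem_of_isBounded hb x
      (norm_ne_zero_iff.mp (by rw [hθ]; exact one_ne_zero))
    refine htL fun p hp ↦ ?_
    rw [inner_add_right, inner_smul_right]
    nlinarith [hx p hp, not_lt.mp (hJ hp)]
  obtain ⟨p, hpJ, hp⟩ := J.exists_min_image (fun p ↦ (p.2 - ⟪p.1, x⟫) / ⟪p.1, θ⟫) hJ
  have hp' := (Finset.mem_filter.mp hpJ)
  set t := (p.2 - ⟪p.1, x⟫) / ⟪p.1, θ⟫
  have ht : 0 ≤ t := div_nonneg (sub_nonneg.mpr (hx p hp'.1)) hp'.2.le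
  refine Set.mem_iUnion₂.mpr ⟨p, hpJ, x + t • θ, ⟨fun q hq ↦ ?_, ?_⟩,
    removeComponent_add_smul hθ x t⟩
  · rw [inner_add_right, inner_smul_right]
    by_cases hqθ : 0 < ⟪q.1, θ⟫
    · have := hp q (Finset.mem_filter.mpr ⟨hq, hqθ⟩)
      rw [le_div_iff₀ hqθ] at this
      linarith
    · nlinarith [hx q hq]
  · rw [inner_add_right, inner_smul_right, div_mul_cancel₀ _ hp'.2.ne']
    ring

theorem removeComponent_image_polytopeFace_inter_subset {I : Finset (E × ℝ)} {θ : E}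
    {p q : E × ℝ} (hp : p ∈ I) (hq : q ∈ I) (hpθ : 0 < ⟪p.1, θ⟫) (hqθ : 0 < ⟪q.1, θ⟫) :
    removeComponent θ '' polytopeFace I p ∩ removeComponent θ '' polytopeFace I q ⊆
      removeComponent θ '' (polytopeFace I p ∩ polytopeFace I q) := by
  rintro _ ⟨⟨x, hx, rfl⟩, ⟨y, hy, hxy⟩⟩
  obtain ⟨t, rfl⟩ := exists_eq_add_smul_of_removeComponent_eq hxy.symm
  have h1 := hy.1 p hp
  have h2 := hx.1 q hq
  have h3 := hy.2
  rw [inner_add_right, inner_smul_right, hx.2] at h1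
  rw [inner_add_right, inner_smul_right] at h3
  have ht : t = 0 := by
    rcases lt_trichotomy t 0 with h | h | h
    · nlinarith
    · exact h
    · nlinarith
  subst ht
  exact ⟨x, ⟨hx, by simpa using hy⟩, rfl⟩

variable [FiniteDimensional ℝ E] [MeasurableSpace E] [BorelSpace E] {m : ℕ}

theorem hausdorffMeasure_polytopeFace_inter (hm : finrank ℝ E = m + 1) {I : Finset (E × ℝ)}
    (hI : ∀ p ∈ I, ‖p.1‖ = 1) (hi : (interior (polytope I)).Nonempty) {p q : E × ℝ} (hp : p ∈ I)
    (hq : q ∈ I) (hpq : p ≠ q) : μH[(m : ℝ)] (polytopeFace I p ∩ polytopeFace I q) = 0 := by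
  by_cases hspan : q.1 ∈ ℝ ∙ p.1
  · suffices polytopeFace I p ∩ polytopeFace I q = ∅ by simp [this]
    refine Set.eq_empty_of_forall_notMem fun x ⟨hxp, hxq⟩ ↦ ?_
    obtain ⟨c, hc⟩ := mem_span_singleton.mp hspan
    have hxp2 := hxp.2
    have hxq2 := hxq.2
    rw [← hc, real_inner_smul_left, hxp2] at hxq2
    have hcabs : |c| = 1 := by
      have := congrArg norm hc
      rwa [norm_smul, hI p hp, hI q hq, mul_one] at this
    rcases eq_or_eq_neg_of_abs_eq hcabs with rfl | rfl
    · exact hpq (Prod.ext (by simpa using hc) (by simpa using hxq2))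
    · obtain ⟨z, hz⟩ := hi
      obtain ⟨t, ht, htL⟩ := exists_pos_add_smul_mem_of_mem_interior hz p.1
      have h1 := htL p hp
      have h2 := interior_subset hz q hq
      rw [inner_add_right, inner_smul_right, real_inner_self_eq_norm_sq, hI p hp] at h1
      rw [← hc, real_inner_smul_left] at h2
      linarith
  · exact hausdorffMeasure_inter_hyperplanes_eq_zero hm (hI p hp) hspan
      (fun x hx ↦ hx.1.2) (fun x hx ↦ hx.2.2)

theorem hausdorffMeasure_frontier_polytope (hm : finrank ℝ E = m + 1) {I : Finset (E × ℝ)}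
    (hI : ∀ p ∈ I, ‖p.1‖ = 1) (hi : (interior (polytope I)).Nonempty) :
    μH[(m : ℝ)] (frontier (polytope I)) = ∑ p ∈ I, μH[(m : ℝ)] (polytopeFace I p) := by
  rw [frontier_polytope hI]
  exact measure_biUnion_finset₀
    (fun p hp q hq hpq ↦ hausdorffMeasure_polytopeFace_inter hm hI hi hp hq hpq)
    fun p _ ↦ (isClosed_polytopeFace I p).measurableSet.nullMeasurableSet

theorem hausdorffMeasure_removeComponent_image_polytope_of_pos (hm : finrank ℝ E = m + 1)
    {I : Finset (E × ℝ)} (hI : ∀ p ∈ I, ‖p.1‖ = 1) (hi : (interior (polytope I)).Nonempty)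
    (hb : Bornology.IsBounded (polytope I)) {θ : E} (hθ : ‖θ‖ = 1) :
    μH[(m : ℝ)] (removeComponent θ '' polytope I) =
      ∑ p ∈ I.filter (fun p ↦ 0 < ⟪p.1, θ⟫),
        ENNReal.ofReal |⟪p.1, θ⟫| * μH[(m : ℝ)] (polytopeFace I p) := by
  rw [removeComponent_image_polytope hb hθ, measure_biUnion_finset₀]
  · refine Finset.sum_congr rfl fun p hp ↦ ?_
    exact hausdorffMeasure_removeComponent_image hm hθ (hI p (Finset.mem_filter.mp hp).1)
      fun x hx ↦ hx.2
  · intro p hp q hq hpq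
    obtain ⟨hp1, hp2⟩ := Finset.mem_filter.mp hp
    obtain ⟨hq1, hq2⟩ := Finset.mem_filter.mp hq
    refine measure_mono_null (removeComponent_image_polytopeFace_inter_subset hp1 hq1 hp2 hq2) ?_
    have h := (lipschitzWith_removeComponent hθ).hausdorffMeasure_image_le (d := m)
      m.cast_nonneg (polytopeFace I p ∩ polytopeFace I q)
    rw [hausdorffMeasure_polytopeFace_inter hm hI hi hp1 hq1 hpq, mul_zero] at h
    exact le_antisymm h bot_le
  · intro p _
    have hc : IsCompact (polytopeFace I p) := Metric.isCompact_of_isClosed_isBounded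
      (isClosed_polytopeFace I p) (hb.subset fun x hx ↦ hx.1)
    exact (hc.image (lipschitzWith_removeComponent hθ).continuous).measurableSet.nullMeasurableSet

theorem two_mul_hausdorffMeasure_removeComponent_image_polytope (hm : finrank ℝ E = m + 1)
    {I : Finset (E × ℝ)} (hI : ∀ p ∈ I, ‖p.1‖ = 1) (hi : (interior (polytope I)).Nonempty)
    (hb : Bornology.IsBounded (polytope I)) {θ : E} (hθ : ‖θ‖ = 1) :
    2 * μH[(m : ℝ)] (removeComponent θ '' polytope I) =
      ∑ p ∈ I, ENNReal.ofReal |⟪p.1, θ⟫| * μH[(m : ℝ)] (polytopeFace I p) := by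
  have h1 := hausdorffMeasure_removeComponent_image_polytope_of_pos hm hI hi hb hθ
  have h2 := hausdorffMeasure_removeComponent_image_polytope_of_pos hm hI hi hb
    (θ := -θ) (by rwa [norm_neg])
  rw [removeComponent_neg] at h2
  rw [two_mul]
  nth_rewrite 1 [h1]
  rw [h2, Finset.sum_filter, Finset.sum_filter, ← Finset.sum_add_distrib]
  refine Finset.sum_congr rfl fun p _ ↦ ?_
  simp only [inner_neg_right, abs_neg, Left.neg_pos_iff]
  rcases lt_trichotomy ⟪p.1, θ⟫ 0 with h | h | h
  · simp [h, h.not_gt]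
  · simp [h]
  · simp [h, h.not_gt]

end Polytope

section MeanAbsInner

theorem exists_linearIsometryEquiv_apply_eq {E : Type*} [NormedAddCommGroup E]
    [InnerProductSpace ℝ E] {u v : E} (h : ‖u‖ = ‖v‖) : ∃ g : E ≃ₗᵢ[ℝ] E, g u = v :=
  ⟨_, reflection_sub h⟩

variable {m : ℕ}

local notation "𝔼" => EuclideanSpace ℝ (Fin (m + 1))

theorem integral_abs_mul_exp_neg_sq : ∫ t : ℝ, |t| * Real.exp (-t ^ 2) = 1 := by
  have h := integral_comp_abs (f := fun t : ℝ ↦ t * Real.exp (-t ^ 2))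
  simp only [sq_abs] at h
  rw [h]
  have h2 := integral_rpow_mul_exp_neg_rpow (p := 2) (q := 1) (by norm_num) (by norm_num)
  norm_num at h2
  rw [h2]
  norm_num

theorem integral_exp_neg_sq : ∫ t : ℝ, Real.exp (-t ^ 2) = √Real.pi := by
  simpa using integral_gaussian 1

theorem integral_abs_inner_mul_exp_neg_norm_sq {θ : 𝔼} (hθ : ‖θ‖ = 1) :
    ∫ x : 𝔼, |⟪x, θ⟫| * Real.exp (-‖x‖ ^ 2) = √Real.pi ^ m := by
  obtain ⟨g, hg⟩ := exists_linearIsometryEquiv_apply_eq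
    (u := EuclideanSpace.single (0 : Fin (m + 1)) (1 : ℝ)) (v := θ) (by simp [hθ])
  rw [← g.measurePreserving.integral_comp g.toHomeomorph.measurableEmbedding]
  simp only [← hg, LinearIsometryEquiv.inner_map_map, LinearIsometryEquiv.norm_map]
  let f : Fin (m + 1) → ℝ → ℝ :=
    Fin.cons (fun t ↦ |t| * Real.exp (-t ^ 2)) fun _ t ↦ Real.exp (-t ^ 2)
  have hprod : ∀ x : 𝔼, |⟪x, EuclideanSpace.single (0 : Fin (m + 1)) (1 : ℝ)⟫| *
      Real.exp (-‖x‖ ^ 2) = ∏ i, f i (WithLp.ofLp x i) := by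
    intro x
    rw [Fin.prod_univ_succ, EuclideanSpace.norm_sq_eq, Fin.sum_univ_succ]
    simp only [f, Fin.cons_zero, Fin.cons_succ, ← Real.exp_sum, EuclideanSpace.inner_single_right]
    simp only [Real.norm_eq_abs, sq_abs, neg_add, Real.exp_add, Finset.sum_neg_distrib]
    simp [mul_assoc]
  simp only [hprod]
  rw [(PiLp.volume_preserving_ofLp (Fin (m + 1))).integral_comp
    (MeasurableEquiv.toLp 2 _).symm.measurableEmbedding (fun y ↦ ∏ i, f i (y i)),
    integral_fintype_prod_volume_eq_prod, Fin.prod_univ_succ]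
  simp [f, integral_abs_mul_exp_neg_sq, integral_exp_neg_sq]

theorem integral_norm_mul_exp_neg_norm_sq :
    ∫ x : 𝔼, ‖x‖ * Real.exp (-‖x‖ ^ 2) =
      (m + 1) * (volume (Metric.ball (0 : 𝔼) 1)).toReal * (Real.Gamma (m / 2 + 1) / 2) := by
  rw [integral_fun_norm_addHaar volume (fun t ↦ t * Real.exp (-t ^ 2))]
  have h := integral_rpow_mul_exp_neg_rpow (p := 2) (q := m + 1) (by norm_num)
    (by have : (0 : ℝ) ≤ m := m.cast_nonneg
        linarith)
  have h2 : ∫ y in Set.Ioi (0 : ℝ), y ^ m * (y * Real.exp (-y ^ 2)) =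
      Real.Gamma (m / 2 + 1) / 2 := by
    rw [show (m / 2 + 1 : ℝ) = (m + 1 + 1) / 2 by ring, div_eq_inv_mul _ (2 : ℝ), ← one_div, ← h]
    refine setIntegral_congr_fun measurableSet_Ioi fun y hy ↦ ?_
    have : y ^ ((m : ℝ) + 1) = y ^ (m + 1) := by exact_mod_cast Real.rpow_natCast y (m + 1)
    simp only [Real.rpow_two, this, pow_succ, mul_assoc]
  simp only [finrank_euclideanSpace, Fintype.card_fin, Nat.add_sub_cancel, smul_eq_mul,
    nsmul_eq_mul, h2, Measure.real]
  push_cast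
  ring

theorem toReal_volume_ball_mul_Gamma (m : ℕ) :
    (volume (Metric.ball (0 : EuclideanSpace ℝ (Fin m)) 1)).toReal * Real.Gamma (m / 2 + 1) =
      √Real.pi ^ m := by
  have hΓ : 0 < Real.Gamma (m / 2 + 1) := Real.Gamma_pos_of_pos (by positivity)
  rcases m.eq_zero_or_pos with rfl | hm
  · have : Metric.ball (0 : EuclideanSpace ℝ (Fin 0)) 1 = Set.univ :=
      Set.eq_univ_of_forall fun x ↦ by simp [Subsingleton.elim x 0]
    simp [this, volume_euclideanSpace_eq_dirac]
  · have : Nonempty (Fin m) := ⟨⟨0, hm⟩⟩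
    rw [EuclideanSpace.volume_ball]
    simp only [ENNReal.ofReal_one, one_pow, one_mul, Fintype.card_fin]
    rw [ENNReal.toReal_ofReal (by positivity), div_mul_cancel₀ _ hΓ.ne']

variable {σ : Measure (EuclideanSpace ℝ (Fin (m + 1)))}

theorem integral_abs_inner_eq_norm_mul (hσ : ∀ g : 𝔼 ≃ₗᵢ[ℝ] 𝔼, σ.map g = σ) {u : 𝔼}
    (hu : ‖u‖ = 1) (x : 𝔼) : ∫ θ, |⟪x, θ⟫| ∂σ = ‖x‖ * ∫ θ, |⟪u, θ⟫| ∂σ := by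
  obtain ⟨g, hg⟩ := exists_linearIsometryEquiv_apply_eq (u := ‖x‖ • u) (v := x)
    (by simp [norm_smul, hu])
  have h : ∫ θ, |⟪x, θ⟫| ∂σ = ∫ θ, |⟪x, θ⟫| ∂(σ.map g) := by rw [hσ g]
  rw [h, show ⇑g = g.toHomeomorph from rfl, g.toHomeomorph.measurableEmbedding.integral_map]
  have hpt : ∀ θ, |⟪x, g.toHomeomorph θ⟫| = ‖x‖ * |⟪u, θ⟫| := fun θ ↦ by
    conv_lhs => rw [← hg]
    change |⟪g (‖x‖ • u), g θ⟫| = _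
    rw [g.inner_map_map, real_inner_smul_left, abs_mul, abs_norm]
  simp only [hpt, integral_const_mul]

variable [IsProbabilityMeasure σ]

theorem ae_norm_eq_one (hσ : σ (Metric.sphere (0 : 𝔼) 1) = 1) : ∀ᵐ θ ∂σ, ‖θ‖ = 1 := by
  have h : Metric.sphere (0 : 𝔼) 1 ∈ ae σ :=
    (mem_ae_iff_prob_eq_one Metric.isClosed_sphere.measurableSet).mpr hσ
  filter_upwards [h] with θ hθ using by simpa using hθ

/-- The mean of `|⟪u, θ⟫|` over the unit sphere of `ℝⁿ` is `2 v_{n-1} / (n v_n)`. -/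
theorem volume_ball_mul_integral_abs_inner (hσ : σ (Metric.sphere (0 : 𝔼) 1) = 1)
    (hσinv : ∀ g : 𝔼 ≃ₗᵢ[ℝ] 𝔼, σ.map g = σ) {u : 𝔼} (hu : ‖u‖ = 1) :
    (m + 1) * (volume (Metric.ball (0 : 𝔼) 1)).toReal * ∫ θ, |⟪u, θ⟫| ∂σ =
      2 * (volume (Metric.ball (0 : EuclideanSpace ℝ (Fin m)) 1)).toReal := by
  have hΓ : 0 < Real.Gamma (m / 2 + 1) := Real.Gamma_pos_of_pos (by positivity)
  have hv : 0 < (volume (Metric.ball (0 : 𝔼) 1)).toReal :=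
    ENNReal.toReal_pos (Metric.measure_ball_pos _ _ one_pos).ne' measure_ball_lt_top.ne
  have hint : Integrable (fun x : 𝔼 ↦ ‖x‖ * Real.exp (-‖x‖ ^ 2)) := by
    refine Integrable.of_integral_ne_zero ?_
    rw [integral_norm_mul_exp_neg_norm_sq]
    positivity
  have hint2 : Integrable (Function.uncurry fun (θ x : 𝔼) ↦ |⟪x, θ⟫| * Real.exp (-‖x‖ ^ 2))
      (σ.prod volume) := by
    refine (hint.comp_snd σ).mono' ?_ ?_
    · have : Continuous (Function.uncurry fun (θ x : 𝔼) ↦ |⟪x, θ⟫| * Real.exp (-‖x‖ ^ 2)) := by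
        unfold Function.uncurry
        fun_prop
      exact this.aestronglyMeasurable
    · filter_upwards [Measure.quasiMeasurePreserving_fst.ae (ae_norm_eq_one hσ)] with z hz
      simp only [Function.uncurry, norm_mul, Real.norm_eq_abs, abs_abs, Real.abs_exp]
      gcongr
      simpa [hz] using abs_real_inner_le_norm z.2 z.1
  have hswap := integral_integral_swap hint2
  have hleft : ∫ θ, (∫ x : 𝔼, |⟪x, θ⟫| * Real.exp (-‖x‖ ^ 2)) ∂σ = √Real.pi ^ m := by
    rw [integral_congr_ae ((ae_norm_eq_one hσ).mono fun θ hθ ↦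
      integral_abs_inner_mul_exp_neg_norm_sq hθ)]
    simp
  rw [hleft] at hswap
  have hnorm := integral_abs_inner_eq_norm_mul hσinv hu
  generalize ∫ θ, |⟪u, θ⟫| ∂σ = J at hnorm ⊢
  simp only [integral_mul_const, hnorm] at hswap
  have hright : ∫ x : 𝔼, ‖x‖ * J * Real.exp (-‖x‖ ^ 2) =
      (∫ x : 𝔼, ‖x‖ * Real.exp (-‖x‖ ^ 2)) * J := by
    rw [← integral_mul_const]
    exact integral_congr_ae (.of_forall fun x ↦ mul_right_comm _ _ _)
  rw [hright, integral_norm_mul_exp_neg_norm_sq, ← toReal_volume_ball_mul_Gamma m] at hswap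
  refine mul_right_cancel₀ hΓ.ne' ?_
  linear_combination -2 * hswap

end MeanAbsInner

section CauchyFormula

open scoped Pointwise
open Filter Topology

theorem frontier_smul_of_ne_zero {E : Type*} [NormedAddCommGroup E] [NormedSpace ℝ E] {r : ℝ}
    (hr : r ≠ 0) (s : Set E) : frontier (r • s) = r • frontier s :=
  ((Homeomorph.smulOfNeZero r hr).image_frontier s).symm

theorem toReal_hausdorffMeasure_smul {E : Type*} [NormedAddCommGroup E] [NormedSpace ℝ E]
    [MeasurableSpace E] [BorelSpace E] {r : ℝ} (hr : 0 < r) (m : ℕ) (s : Set E) :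
    (μH[(m : ℝ)] (r • s)).toReal = r ^ m * (μH[(m : ℝ)] s).toReal := by
  rw [Measure.hausdorffMeasure_smul₀ m.cast_nonneg hr.ne']
  simp [abs_of_pos hr]

theorem tendsto_of_le_of_le_pow_mul {a : ℝ} {u r : ℕ → ℝ} {m : ℕ} (hr : Tendsto r atTop (𝓝 1))
    (h : ∀ k, a ≤ u k) (h' : ∀ k, u k ≤ r k ^ m * a) : Tendsto u atTop (𝓝 a) := by
  refine tendsto_of_tendsto_of_tendsto_of_le_of_le tendsto_const_nhds ?_ h h'
  simpa using (hr.pow m).mul_const a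

variable {m : ℕ}

local notation "𝔼" => EuclideanSpace ℝ (Fin (m + 1))

theorem hausdorffMeasure_polytopeFace_ne_top {I : Finset (𝔼 × ℝ)} (hI : ∀ p ∈ I, ‖p.1‖ = 1)
    (hb : Bornology.IsBounded (polytope I)) {p : 𝔼 × ℝ} (hp : p ∈ I) :
    μH[(m : ℝ)] (polytopeFace I p) ≠ ⊤ :=
  (hausdorffMeasure_lt_top_of_subset_hyperplane finrank_euclideanSpace_fin (hI p hp)
    (fun _ hx ↦ hx.2) (hb.subset fun _ hx ↦ hx.1)).ne

theorem hausdorffMeasure_frontier_polytope_ne_top {I : Finset (𝔼 × ℝ)}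
    (hI : ∀ p ∈ I, ‖p.1‖ = 1) (hi : (interior (polytope I)).Nonempty)
    (hb : Bornology.IsBounded (polytope I)) : μH[(m : ℝ)] (frontier (polytope I)) ≠ ⊤ := by
  rw [hausdorffMeasure_frontier_polytope finrank_euclideanSpace_fin hI hi]
  exact ENNReal.sum_ne_top.mpr fun p hp ↦ hausdorffMeasure_polytopeFace_ne_top hI hb hp

theorem toReal_hausdorffMeasure_frontier_polytope {I : Finset (𝔼 × ℝ)}
    (hI : ∀ p ∈ I, ‖p.1‖ = 1) (hi : (interior (polytope I)).Nonempty)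
    (hb : Bornology.IsBounded (polytope I)) :
    (μH[(m : ℝ)] (frontier (polytope I))).toReal =
      ∑ p ∈ I, (μH[(m : ℝ)] (polytopeFace I p)).toReal := by
  rw [hausdorffMeasure_frontier_polytope finrank_euclideanSpace_fin hI hi,
    ENNReal.toReal_sum fun p hp ↦ hausdorffMeasure_polytopeFace_ne_top hI hb hp]

theorem hausdorffMeasure_removeComponent_image_polytope_ne_top {I : Finset (𝔼 × ℝ)}
    (hI : ∀ p ∈ I, ‖p.1‖ = 1) (hi : (interior (polytope I)).Nonempty)
    (hb : Bornology.IsBounded (polytope I)) {θ : 𝔼} (hθ : ‖θ‖ = 1) :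
    μH[(m : ℝ)] (removeComponent θ '' polytope I) ≠ ⊤ := by
  rw [hausdorffMeasure_removeComponent_image_polytope_of_pos finrank_euclideanSpace_fin hI hi hb hθ]
  exact ENNReal.sum_ne_top.mpr fun p hp ↦ ENNReal.mul_ne_top ENNReal.ofReal_ne_top
    (hausdorffMeasure_polytopeFace_ne_top hI hb (Finset.mem_filter.mp hp).1)

theorem toReal_hausdorffMeasure_removeComponent_image_polytope {I : Finset (𝔼 × ℝ)}
    (hI : ∀ p ∈ I, ‖p.1‖ = 1) (hi : (interior (polytope I)).Nonempty)
    (hb : Bornology.IsBounded (polytope I)) {θ : 𝔼} (hθ : ‖θ‖ = 1) :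
    (μH[(m : ℝ)] (removeComponent θ '' polytope I)).toReal =
      (∑ p ∈ I, |⟪p.1, θ⟫| * (μH[(m : ℝ)] (polytopeFace I p)).toReal) / 2 := by
  have h := congrArg ENNReal.toReal (two_mul_hausdorffMeasure_removeComponent_image_polytope
    finrank_euclideanSpace_fin hI hi hb hθ)
  rw [ENNReal.toReal_mul, ENNReal.toReal_sum fun p hp ↦ ENNReal.mul_ne_top ENNReal.ofReal_ne_top
    (hausdorffMeasure_polytopeFace_ne_top hI hb hp)] at h
  simp only [ENNReal.toReal_mul, ENNReal.toReal_ofReal (abs_nonneg _), ENNReal.toReal_ofNat] at h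
  linarith

theorem toReal_hausdorffMeasure_removeComponent_image_polytope_le {I : Finset (𝔼 × ℝ)}
    (hI : ∀ p ∈ I, ‖p.1‖ = 1) (hi : (interior (polytope I)).Nonempty)
    (hb : Bornology.IsBounded (polytope I)) {θ : 𝔼} (hθ : ‖θ‖ = 1) :
    (μH[(m : ℝ)] (removeComponent θ '' polytope I)).toReal ≤
      (μH[(m : ℝ)] (frontier (polytope I))).toReal := by
  rw [toReal_hausdorffMeasure_removeComponent_image_polytope hI hi hb hθ,
    toReal_hausdorffMeasure_frontier_polytope hI hi hb]
  refine (half_le_self (Finset.sum_nonneg fun p _ ↦ by positivity)).trans ?_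
  refine Finset.sum_le_sum fun p hp ↦ mul_le_of_le_one_left ENNReal.toReal_nonneg ?_
  simpa [hI p hp, hθ] using abs_real_inner_le_norm p.1 θ

variable {σ : Measure (EuclideanSpace ℝ (Fin (m + 1)))}

theorem toReal_hausdorffMeasure_removeComponent_image_polytope_ae_eq
    (hσ : ∀ᵐ θ ∂σ, ‖θ‖ = 1) {I : Finset (𝔼 × ℝ)} (hI : ∀ p ∈ I, ‖p.1‖ = 1)
    (hi : (interior (polytope I)).Nonempty) (hb : Bornology.IsBounded (polytope I)) :
    (fun θ ↦ (μH[(m : ℝ)] (removeComponent θ '' polytope I)).toReal) =ᵐ[σ]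
      fun θ ↦ (∑ p ∈ I, |⟪p.1, θ⟫| * (μH[(m : ℝ)] (polytopeFace I p)).toReal) / 2 :=
  hσ.mono fun _ hθ ↦ toReal_hausdorffMeasure_removeComponent_image_polytope hI hi hb hθ

variable [IsProbabilityMeasure σ]

theorem integral_hausdorffMeasure_removeComponent_image_polytope
    (hσ : ∀ᵐ θ ∂σ, ‖θ‖ = 1) (hσinv : ∀ g : 𝔼 ≃ₗᵢ[ℝ] 𝔼, σ.map g = σ) {u : 𝔼} (hu : ‖u‖ = 1)
    {I : Finset (𝔼 × ℝ)} (hI : ∀ p ∈ I, ‖p.1‖ = 1) (hi : (interior (polytope I)).Nonempty)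
    (hb : Bornology.IsBounded (polytope I)) :
    ∫ θ, (μH[(m : ℝ)] (removeComponent θ '' polytope I)).toReal ∂σ =
      (∫ θ, |⟪u, θ⟫| ∂σ) * (μH[(m : ℝ)] (frontier (polytope I))).toReal / 2 := by
  have hint : ∀ p ∈ I, Integrable
      (fun θ ↦ |⟪p.1, θ⟫| * (μH[(m : ℝ)] (polytopeFace I p)).toReal) σ := by
    refine fun p hp ↦ Integrable.mul_const ?_ _
    refine (integrable_const (1 : ℝ)).mono' (by fun_prop) (hσ.mono fun θ hθ ↦ ?_)
    simpa [hI p hp, hθ] using abs_real_inner_le_norm p.1 θ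
  rw [integral_congr_ae (toReal_hausdorffMeasure_removeComponent_image_polytope_ae_eq hσ hI hi hb),
    integral_div, integral_finsetSum I hint,
    toReal_hausdorffMeasure_frontier_polytope hI hi hb, Finset.mul_sum]
  congr 1
  refine Finset.sum_congr rfl fun p hp ↦ ?_
  rw [integral_mul_const, integral_abs_inner_eq_norm_mul hσinv hu, hI p hp, one_mul]

theorem integral_hausdorffMeasure_removeComponent_image_of_zero_mem_interior
    (hσ : ∀ᵐ θ ∂σ, ‖θ‖ = 1) (hσinv : ∀ g : 𝔼 ≃ₗᵢ[ℝ] 𝔼, σ.map g = σ) {u : 𝔼} (hu : ‖u‖ = 1)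
    {C : Set 𝔼} (hC : Convex ℝ C) (hCc : IsCompact C) (h0 : 0 ∈ interior C) :
    ∫ θ, (μH[(m : ℝ)] (removeComponent θ '' C)).toReal ∂σ =
      (∫ θ, |⟪u, θ⟫| ∂σ) * (μH[(m : ℝ)] (frontier C)).toReal / 2 := by
  set r : ℕ → ℝ := fun k ↦ 1 + 1 / ((k : ℝ) + 1)
  have hr1 : ∀ k, 1 < r k := fun k ↦ by
    simp only [r]
    linarith [Nat.one_div_pos_of_nat (α := ℝ) (n := k)]
  have hr0 : ∀ k, 0 < r k := fun k ↦ one_pos.trans (hr1 k)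
  have hr2 : ∀ k, r k ≤ 2 := fun k ↦ by
    have : 1 / ((k : ℝ) + 1) ≤ 1 := (div_le_one (by positivity)).mpr (by simp)
    simp only [r]
    linarith
  have hrt : Tendsto r atTop (𝓝 1) := by
    have h := (tendsto_const_nhds (x := (1 : ℝ))).add
      (tendsto_one_div_add_atTop_nhds_zero_nat (𝕜 := ℝ))
    rwa [add_zero] at h
  choose I hI hCI hIC using fun k ↦ exists_polytope_between hC hCc h0 (hr1 k)
  have hi : ∀ k, (interior (polytope (I k))).Nonempty := fun k ↦ ⟨0, interior_mono (hCI k) h0⟩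
  have hb : ∀ k, Bornology.IsBounded (polytope (I k)) := fun k ↦
    (hCc.smul (r k)).isBounded.subset (hIC k)
  have hCfin : μH[(m : ℝ)] (frontier C) ≠ ⊤ :=
    ne_top_of_le_ne_top (hausdorffMeasure_frontier_polytope_ne_top (hI 0) (hi 0) (hb 0))
      (hausdorffMeasure_frontier_mono hC hCc.isClosed ⟨0, h0⟩ (hCI 0) (hb 0) m.cast_nonneg)
  have hle : ∀ k, (μH[(m : ℝ)] (frontier C)).toReal ≤
      (μH[(m : ℝ)] (frontier (polytope (I k)))).toReal := fun k ↦
    ENNReal.toReal_mono (hausdorffMeasure_frontier_polytope_ne_top (hI k) (hi k) (hb k))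
      (hausdorffMeasure_frontier_mono hC hCc.isClosed ⟨0, h0⟩ (hCI k) (hb k) m.cast_nonneg)
  have hge : ∀ k, (μH[(m : ℝ)] (frontier (polytope (I k)))).toReal ≤
      r k ^ m * (μH[(m : ℝ)] (frontier C)).toReal := fun k ↦ by
    rw [← toReal_hausdorffMeasure_smul (hr0 k), ← frontier_smul_of_ne_zero (hr0 k).ne']
    refine ENNReal.toReal_mono ?_ (hausdorffMeasure_frontier_mono (convex_polytope _)
      (isClosed_polytope _) (hi k) (hIC k) (hCc.smul (r k)).isBounded m.cast_nonneg)
    rw [frontier_smul_of_ne_zero (hr0 k).ne',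
      Measure.hausdorffMeasure_smul₀ m.cast_nonneg (hr0 k).ne']
    exact ENNReal.mul_ne_top ENNReal.coe_ne_top hCfin
  have hS := tendsto_of_le_of_le_pow_mul hrt hle hge
  have hP : ∀ᵐ θ ∂σ, Tendsto (fun k ↦ (μH[(m : ℝ)] (removeComponent θ '' polytope (I k))).toReal)
      atTop (𝓝 (μH[(m : ℝ)] (removeComponent θ '' C)).toReal) := by
    filter_upwards [hσ] with θ hθ
    have htop := fun k ↦
      hausdorffMeasure_removeComponent_image_polytope_ne_top (hI k) (hi k) (hb k) hθ
    refine tendsto_of_le_of_le_pow_mul (m := m) hrt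
      (fun k ↦ ENNReal.toReal_mono (htop k) (measure_mono (Set.image_mono (hCI k)))) fun k ↦ ?_
    rw [← toReal_hausdorffMeasure_smul (hr0 k), ← image_smul_set]
    refine ENNReal.toReal_mono ?_ (measure_mono (Set.image_mono (hIC k)))
    rw [image_smul_set, Measure.hausdorffMeasure_smul₀ m.cast_nonneg (hr0 k).ne']
    exact ENNReal.mul_ne_top ENNReal.coe_ne_top
      (ne_top_of_le_ne_top (htop 0) (measure_mono (Set.image_mono (hCI 0))))
  have hlim := tendsto_integral_of_dominated_convergence
    (fun _ ↦ 2 ^ m * (μH[(m : ℝ)] (frontier C)).toReal) (fun k ↦ ?_) (integrable_const _)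
    (fun k ↦ ?_) hP
  · simp only [integral_hausdorffMeasure_removeComponent_image_polytope hσ hσinv hu (hI _) (hi _)
      (hb _)] at hlim
    exact tendsto_nhds_unique hlim ((hS.const_mul _).div_const 2)
  · exact AEStronglyMeasurable.congr (by fun_prop)
      (toReal_hausdorffMeasure_removeComponent_image_polytope_ae_eq hσ (hI k) (hi k) (hb k)).symm
  · filter_upwards [hσ] with θ hθ
    rw [Real.norm_of_nonneg ENNReal.toReal_nonneg]
    refine (toReal_hausdorffMeasure_removeComponent_image_polytope_le (hI k) (hi k) (hb k) hθ).trans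
      ((hge k).trans ?_)
    gcongr
    exact hr2 k

theorem integral_hausdorffMeasure_removeComponent_image
    (hσ : ∀ᵐ θ ∂σ, ‖θ‖ = 1) (hσinv : ∀ g : 𝔼 ≃ₗᵢ[ℝ] 𝔼, σ.map g = σ) {u : 𝔼} (hu : ‖u‖ = 1)
    {C : Set 𝔼} (hC : Convex ℝ C) (hCc : IsCompact C) (hCi : (interior C).Nonempty) :
    ∫ θ, (μH[(m : ℝ)] (removeComponent θ '' C)).toReal ∂σ =
      (∫ θ, |⟪u, θ⟫| ∂σ) * (μH[(m : ℝ)] (frontier C)).toReal / 2 := by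
  obtain ⟨c, hc⟩ := hCi
  set D : Set 𝔼 := (fun x ↦ -c + x) '' C
  have hint : interior D = (fun x ↦ -c + x) '' interior C :=
    ((Homeomorph.addLeft (-c)).image_interior C).symm
  have hfr : frontier D = (fun x ↦ -c + x) '' frontier C :=
    ((Homeomorph.addLeft (-c)).image_frontier C).symm
  have h := integral_hausdorffMeasure_removeComponent_image_of_zero_mem_interior hσ hσinv hu
    (C := D) (hC.translate (-c)) (hCc.image (by fun_prop)) (by rw [hint]; exact ⟨c, hc, by simp⟩)
  rw [hfr, hausdorffMeasure_vadd_set] at h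
  rw [← h]
  congr 1 with θ
  rw [← hausdorffMeasure_vadd_set (removeComponent θ (-c)) (removeComponent θ '' C)]
  simp only [D, Set.image_image, map_add]

end CauchyFormula

/-- Cauchy's formula: for a convex body `C` in `ℝⁿ`, the surface area `|∂C|` equals
`(n v_n / v_{n-1}) ∫_{S^{n-1}} |P_θ C| dσ(θ)`, where `v_k` is the volume of the unit ball
in `ℝᵏ` and `σ` is the rotation-invariant probability measure on the unit sphere
(formalized as a probability measure on `ℝⁿ` carried by the sphere and invariant under
all linear isometries). -/
theorem stmt_19 (n : ℕ) (hn : 0 < n) (C : Set (EuclideanSpace ℝ (Fin n)))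
    (hC : Convex ℝ C) (hCc : IsCompact C) (hCi : (interior C).Nonempty)
    (σ : Measure (EuclideanSpace ℝ (Fin n))) [IsProbabilityMeasure σ]
    (hσsphere : σ (Metric.sphere (0 : EuclideanSpace ℝ (Fin n)) 1) = 1)
    (hσinv : ∀ g : EuclideanSpace ℝ (Fin n) ≃ₗᵢ[ℝ] EuclideanSpace ℝ (Fin n),
      σ.map g = σ) :
    (μH[(n : ℝ) - 1] (frontier C)).toReal =
      ((n : ℝ) * (volume (Metric.ball (0 : EuclideanSpace ℝ (Fin n)) 1)).toReal /
          (volume (Metric.ball (0 : EuclideanSpace ℝ (Fin (n - 1))) 1)).toReal) *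
        ∫ θ, (μH[(n : ℝ) - 1] ((fun x => x - ⟪θ, x⟫ • θ) '' C)).toReal ∂σ := by
  obtain ⟨m, rfl⟩ := Nat.exists_eq_add_one.mpr hn
  have hu : ‖EuclideanSpace.single (0 : Fin (m + 1)) (1 : ℝ)‖ = 1 := by simp
  have hv : (volume (Metric.ball (0 : EuclideanSpace ℝ (Fin m)) 1)).toReal ≠ 0 :=
    (ENNReal.toReal_pos (Metric.measure_ball_pos _ _ one_pos).ne' measure_ball_lt_top.ne).ne'
  have hmean := volume_ball_mul_integral_abs_inner hσsphere hσinv hu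
  have h := integral_hausdorffMeasure_removeComponent_image (ae_norm_eq_one hσsphere) hσinv hu
    hC hCc hCi
  rw [show ((m + 1 : ℕ) : ℝ) - 1 = m by simp]
  change _ = _ * ∫ θ, (μH[(m : ℝ)] (removeComponent θ '' C)).toReal ∂σ
  rw [h, Nat.add_sub_cancel]
  push_cast
  field_simp
  linear_combination -(μH[(m : ℝ)] (frontier C)).toReal * hmean
end
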